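/- arXiv:2603.27932 — 10 statements merged into one kernel-verified Lean document; each statement's English description precedes it below -/
import Mathlib

section
/- Let n ≥ 1 and let r be an integer with 1 ≤ r ≤ n. Let λ : {1,…,n+1} → ℂ. Then the following are equivalent: (a) there exists a permutation σ of {1,…,n+1} such that the vector v(i) := λ(i) − λ(σ(i)) satisfies v(i) ∈ {0, 1} for all 1 ≤ i ≤ r, v(i) ∈ {0, −1} for all r < i ≤ n+1, and the number of indices i with v(i) = 1 is positive and equal to the number of indices i with v(i) = −1; (b) there exist indices i₁, i₂ with 1 ≤ i₁ ≤ r < i₂ ≤ n+1 and λ(i₁) − λ(i₂) = 1. -/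
open scoped Classical

/-- If a permutation `σ` lowers `f` by `1` at some index, then at some such index `i` the value
`f i - 1` is taken at an index `j` where `σ` neither preserves `f` nor lowers it by `1`. -/
lemma exists_sub_eq_one_of_perm {ι : Type*} [Finite ι] (f : ι → ℂ) (σ : Equiv.Perm ι)
    (h : ∃ i, f i - f (σ i) = 1) :
    ∃ i j, f i - f (σ i) = 1 ∧ f i - f j = 1 ∧ f j - f (σ j) ≠ 0 ∧ f j - f (σ j) ≠ 1 := by
  obtain ⟨i, hi, hmin⟩ := Set.exists_min_image {i | f i - f (σ i) = 1} (fun i => (f i).re)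
    (Set.toFinite _) h
  simp only [Set.mem_ofPred_eq] at hi hmin
  by_contra! H
  have key : ∀ j, f i - f j = 1 → f i - f (σ j) = 1 := by
    intro j hj
    by_cases h0 : f j - f (σ j) = 0
    · rwa [← sub_eq_zero.mp h0]
    · have hle := hmin j (H i j hi hj h0)
      have hre := congrArg Complex.re hj
      simp only [Complex.sub_re, Complex.one_re] at hre
      linarith
  have hinv := Equiv.Perm.perm_symm_on_of_perm_on_finite (p := fun j => f i - f j = 1)
    (f := σ) key hi
  simp at hinv

/-- Type `A_n` case of the characterization of sufficiently regular weights.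
Indices `{1, …, n+1}` are modelled by `Fin (n+1)` (zero-based), so the 1-based
condition `1 ≤ i ≤ r` becomes `(i : ℕ) < r` and `r < i ≤ n+1` becomes `r ≤ (i : ℕ)`. -/
theorem typeA_sufficiently_regular (n r : ℕ) (hn : 1 ≤ n) (hr1 : 1 ≤ r) (hrn : r ≤ n)
    (lam : Fin (n + 1) → ℂ) :
    (∃ σ : Equiv.Perm (Fin (n + 1)),
      (∀ i : Fin (n + 1), (i : ℕ) < r →
        lam i - lam (σ i) = 0 ∨ lam i - lam (σ i) = 1) ∧
      (∀ i : Fin (n + 1), r ≤ (i : ℕ) →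
        lam i - lam (σ i) = 0 ∨ lam i - lam (σ i) = -1) ∧
      0 < (Finset.univ.filter fun i : Fin (n + 1) => lam i - lam (σ i) = 1).card ∧
      (Finset.univ.filter fun i : Fin (n + 1) => lam i - lam (σ i) = 1).card =
        (Finset.univ.filter fun i : Fin (n + 1) => lam i - lam (σ i) = -1).card) ↔
    ∃ i₁ i₂ : Fin (n + 1), (i₁ : ℕ) < r ∧ r ≤ (i₂ : ℕ) ∧ lam i₁ - lam i₂ = 1 := by
  constructor
  · rintro ⟨σ, hlow, hhigh, hpos, -⟩
    obtain ⟨i₀, hi₀⟩ := Finset.card_pos.mp hpos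
    obtain ⟨i, j, hi, hij, hj0, hj1⟩ :=
      exists_sub_eq_one_of_perm lam σ ⟨i₀, (Finset.mem_filter.mp hi₀).2⟩
    refine ⟨i, j, ?_, ?_, hij⟩
    · by_contra! hri
      rcases hhigh i hri with h | h <;> rw [hi] at h <;> norm_num at h
    · by_contra! hjr
      exact (hlow j hjr).elim hj0 hj1
  · rintro ⟨i₁, i₂, h₁, h₂, h⟩
    have hne : i₁ ≠ i₂ := by
      rintro rfl
      omega
    have h' : lam i₂ - lam i₁ = -1 := by rw [← h, neg_sub]
    have hfix : ∀ i, i ≠ i₁ → i ≠ i₂ → lam i - lam (Equiv.swap i₁ i₂ i) = 0 := by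
      intro i hi₁ hi₂
      rw [Equiv.swap_apply_of_ne_of_ne hi₁ hi₂, sub_self]
    have hone : (Finset.univ.filter fun i => lam i - lam (Equiv.swap i₁ i₂ i) = 1) = {i₁} := by
      ext i
      simp only [Finset.mem_filter, Finset.mem_univ, true_and, Finset.mem_singleton]
      refine ⟨fun hi => ?_, fun hi => by rw [hi, Equiv.swap_apply_left, h]⟩
      by_contra hi₁
      by_cases hi₂ : i = i₂
      · rw [hi₂, Equiv.swap_apply_right, h'] at hi
        norm_num at hi
      · rw [hfix i hi₁ hi₂] at hi
        norm_num at hi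
    have hneg : (Finset.univ.filter fun i => lam i - lam (Equiv.swap i₁ i₂ i) = -1) = {i₂} := by
      ext i
      simp only [Finset.mem_filter, Finset.mem_univ, true_and, Finset.mem_singleton]
      refine ⟨fun hi => ?_, fun hi => by rw [hi, Equiv.swap_apply_right, h']⟩
      by_contra hi₂
      by_cases hi₁ : i = i₁
      · rw [hi₁, Equiv.swap_apply_left, h] at hi
        norm_num at hi
      · rw [hfix i hi₁ hi₂] at hi
        norm_num at hi
    refine ⟨Equiv.swap i₁ i₂, fun i hi => ?_, fun i hi => ?_, ?_, ?_⟩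
    · by_cases hi₁ : i = i₁
      · right
        rw [hi₁, Equiv.swap_apply_left, h]
      · refine Or.inl (hfix i hi₁ ?_)
        rintro rfl
        omega
    · by_cases hi₂ : i = i₂
      · right
        rw [hi₂, Equiv.swap_apply_right, h']
      · refine Or.inl (hfix i ?_ hi₂)
        rintro rfl
        omega
    · rw [hone, Finset.card_singleton]
      exact one_pos
    · rw [hone, hneg, Finset.card_singleton, Finset.card_singleton]
end

section
/- Let n ≥ 2 and λ : {1,…,n} → ℂ. Then the following are equivalent: (a) there exists a signed permutation (σ, ε) of {1,…,n} whose difference vector v(i) = λ(i) − ε(i)·λ(σ(i)) equals one of the vectors 2·e₁, e₁, or e₁ + s·e_i for some index 2 ≤ i ≤ n and some sign s ∈ {1, −1}; (b) 2·λ(1) ∈ {1, 2}, or there exist an index 2 ≤ i ≤ n and a sign s ∈ {1, −1} with λ(1) + s·λ(i) = 1. -/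
/-- A signed permutation preserves the sum of squares, expressed through the difference vector. -/
theorem sum_signedPerm_difference {ι R : Type*} [Fintype ι] [CommRing R] (lam v ε : ι → R)
    (σ : Equiv.Perm ι) (hε : ∀ i, ε i = 1 ∨ ε i = -1)
    (hv : (fun i => lam i - ε i * lam (σ i)) = v) :
    ∑ i, v i * (2 * lam i - v i) = 0 := by
  have h : ∀ i, v i * (2 * lam i - v i) = lam i ^ 2 - lam (σ i) ^ 2 := by
    intro i
    rw [← hv]
    rcases hε i with h | h <;> simp only [h] <;> ring
  simp only [h, Finset.sum_sub_distrib, Equiv.sum_comp σ fun i => lam i ^ 2, sub_self]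

/-- Type `B_n` case of the characterization of sufficiently regular weights.
Indices `{1, …, n}` are modelled by `Fin n` (zero-based), so the index `1` is
`⟨0, _⟩` and `2 ≤ i ≤ n` becomes `1 ≤ (i : ℕ)`.  A signed permutation is a pair
`(σ, ε)` with `σ` a permutation and `ε` taking values in `{1, -1}`; its difference
vector is `i ↦ λ i - ε i * λ (σ i)`. -/
theorem typeB_sufficiently_regular (n : ℕ) (hn : 2 ≤ n) (lam : Fin n → ℂ) :
    (∃ (σ : Equiv.Perm (Fin n)) (ε : Fin n → ℂ),
      (∀ i, ε i = 1 ∨ ε i = -1) ∧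
      ((fun i => lam i - ε i * lam (σ i)) =
          (fun i : Fin n => if (i : ℕ) = 0 then (2 : ℂ) else 0) ∨
        (fun i => lam i - ε i * lam (σ i)) =
          (fun i : Fin n => if (i : ℕ) = 0 then (1 : ℂ) else 0) ∨
        ∃ (j : Fin n) (s : ℂ), 1 ≤ (j : ℕ) ∧ (s = 1 ∨ s = -1) ∧
          (fun i => lam i - ε i * lam (σ i)) =
            (fun i : Fin n =>
              (if (i : ℕ) = 0 then (1 : ℂ) else 0) + s * (if i = j then 1 else 0)))) ↔
    (2 * lam ⟨0, by omega⟩ = 1 ∨ 2 * lam ⟨0, by omega⟩ = 2 ∨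
      ∃ (j : Fin n) (s : ℂ), 1 ≤ (j : ℕ) ∧ (s = 1 ∨ s = -1) ∧
        lam ⟨0, by omega⟩ + s * lam j = 1) := by
  have hz : ∀ i : Fin n, (i : ℕ) = 0 ↔ i = ⟨0, by omega⟩ := fun i => by simp [Fin.ext_iff]
  simp only [hz]
  generalize (⟨0, by omega⟩ : Fin n) = z at hz ⊢
  constructor
  · rintro ⟨σ, ε, hε, h | h | ⟨j, s, hj, hs, h⟩⟩
    · have key := sum_signedPerm_difference lam _ ε σ hε h
      simp only [ite_mul, zero_mul, Finset.sum_ite_eq', Finset.mem_univ, if_true] at key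
      right; left
      linear_combination key / 2
    · have key := sum_signedPerm_difference lam _ ε σ hε h
      simp only [ite_mul, zero_mul, Finset.sum_ite_eq', Finset.mem_univ, if_true] at key
      left
      linear_combination key
    · have key := sum_signedPerm_difference lam _ ε σ hε h
      have hjz : j ≠ z := fun e => by have := (hz j).2 e; omega
      simp only [add_mul, mul_assoc, ite_mul, zero_mul, one_mul, mul_ite, mul_zero,
        Finset.sum_add_distrib, Finset.sum_ite_eq', Finset.mem_univ, if_true, hjz, hjz.symm,
        if_false] at key
      refine Or.inr (Or.inr ⟨j, s, hj, hs, ?_⟩)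
      rcases hs with rfl | rfl <;> linear_combination key / 2
  · have reflect : ∀ i, lam i - (if i = z then (-1 : ℂ) else 1) * lam ((1 : Equiv.Perm (Fin n)) i)
        = if i = z then 2 * lam z else 0 := by
      intro i
      by_cases hi : i = z
      · simp [hi, two_mul]
      · simp [hi]
    rintro (h | h | ⟨j, s, hj, hs, h⟩)
    · refine ⟨1, fun i => if i = z then -1 else 1, fun i => by by_cases hi : i = z <;> simp [hi],
        Or.inr (Or.inl (funext fun i => ?_))⟩
      rw [reflect, h]
    · refine ⟨1, fun i => if i = z then -1 else 1, fun i => by by_cases hi : i = z <;> simp [hi],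
        Or.inl (funext fun i => ?_)⟩
      rw [reflect, h]
    · have hjz : j ≠ z := fun e => by have := (hz j).2 e; omega
      refine ⟨Equiv.swap z j, fun i => if i = z ∨ i = j then -s else 1, fun i => ?_,
        Or.inr (Or.inr ⟨j, s, hj, hs, funext fun i => ?_⟩)⟩
      · by_cases hi : i = z ∨ i = j
        · rcases hs with rfl | rfl <;> simp [hi]
        · simp [hi]
      · by_cases hi : i = z
        · subst hi
          simp [hjz.symm, h]
        · by_cases hij : i = j
          · subst hij
            simp only [hi, or_true, if_true, if_false, Equiv.swap_apply_right]
            rcases hs with rfl | rfl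
            · linear_combination h
            · linear_combination -h
          · simp [hi, hij, Equiv.swap_apply_of_ne_of_ne hi hij]
end

section
/- Let n ≥ 1 and λ : {1,…,n} → ℂ. Then the following are equivalent: (a) there exists a signed permutation (σ, ε) of {1,…,n} whose difference vector v(i) = λ(i) − ε(i)·λ(σ(i)) is nonzero, satisfies v(i) ∈ {0, 1, 2} for all i, and the number of indices i with v(i) = 1 is even; (b) there exist distinct indices i ≠ j with λ(i) + λ(j) ∈ {1, 2}, or there exists an index i with λ(i) = 1. -/
open scoped Classical

/-- If no two distinct coordinates sum to `1` or `2` and no coordinate is `1`, then a nonzero entry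
of a difference vector with entries in `{0, 1, 2}` can only be a `1` at a coordinate `1 / 2`. -/
theorem eq_half_of_sub_ne_zero {ι : Type*} [Finite ι] {lam ε : ι → ℂ} {σ : Equiv.Perm ι}
    (hpair : ∀ i j, lam i + lam j = 1 ∨ lam i + lam j = 2 → i = j)
    (hone : ∀ i, lam i ≠ 1) (hε : ∀ i, ε i = 1 ∨ ε i = -1)
    (hv : ∀ i, lam i - ε i * lam (σ i) = 0 ∨ lam i - ε i * lam (σ i) = 1 ∨
      lam i - ε i * lam (σ i) = 2)
    (i : ι) (hi : lam i - ε i * lam (σ i) ≠ 0) :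
    lam i = 1 / 2 ∧ lam i - ε i * lam (σ i) = 1 := by
  have hsum (i j : ι) (h : lam i + lam j = 1 ∨ lam i + lam j = 2) :
      lam i = 1 / 2 ∧ lam i + lam j = 1 := by
    obtain rfl := hpair i j h
    rcases h with h | h
    · exact ⟨by linear_combination h / 2, h⟩
    · exact absurd (by linear_combination h / 2) (hone i)
  rcases hε i with he | he
  swap
  · simp only [he, neg_mul, one_mul, sub_neg_eq_add] at hi ⊢
    have h := hv i
    simp only [he, neg_mul, one_mul, sub_neg_eq_add] at h
    exact hsum i (σ i) (h.resolve_left hi)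
  by_contra hbad
  let Bad : Set ι := {k | ε k = 1 ∧ lam k - lam (σ k) ≠ 0 ∧
    ¬ (lam k = 1 / 2 ∧ lam k - lam (σ k) = 1)}
  have hdrop (k : ι) (hk : k ∈ Bad) : lam k - lam (σ k) = 1 ∨ lam k - lam (σ k) = 2 := by
    have h := hv k
    simp only [hk.1, one_mul] at h
    exact h.resolve_left hk.2.1
  have hneg (k : ι) (hk : k ∈ Bad) (l : ι) : lam l ≠ -lam (σ k) := by
    intro hl
    have hkl : lam k + lam l = lam k - lam (σ k) := by rw [hl]; ring
    have h := hsum k l (by rw [hkl]; exact hdrop k hk)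
    rw [hkl] at h
    exact hk.2.2 h
  have hnext (k : ι) (hk : k ∈ Bad) : ∃ l ∈ Bad, (lam l).re < (lam k).re := by
    obtain ⟨l, hl, hl'⟩ : ∃ l, lam l = lam (σ k) ∧ lam (σ l) ≠ lam (σ k) := by
      by_contra! hall
      have hmaps : Set.MapsTo σ {l | lam l = lam (σ k)} {l | lam l = lam (σ k)} :=
        fun l hl => hall l hl
      have hk' : lam (σ.symm (σ k)) = lam (σ k) :=
        Equiv.Perm.perm_symm_mapsTo_of_mapsTo σ hmaps (show lam (σ k) = lam (σ k) from rfl)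
      rw [Equiv.symm_apply_apply] at hk'
      exact hk.2.1 (sub_eq_zero.2 hk')
    refine ⟨l, ⟨?_, ?_, ?_⟩, ?_⟩
    · refine (hε l).resolve_right fun hel => ?_
      have h := hv l
      simp only [hel, neg_mul, one_mul, sub_neg_eq_add] at h
      rcases h with h | h
      · exact hneg k hk (σ l) (by linear_combination h - hl)
      · exact hl' (by rw [← hpair l (σ l) h, hl])
    · rw [hl]
      exact sub_ne_zero.2 hl'.symm
    · rintro ⟨h1, h2⟩
      exact hneg k hk (σ l) (by linear_combination 2 * h1 - h2 - hl)
    · rw [hl]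
      rcases hdrop k hk with h | h <;>
        · have := congrArg Complex.re h
          simp only [Complex.sub_re, Complex.one_re, Complex.re_ofNat] at this
          linarith
  have hmem : i ∈ Bad := by
    simp only [he, one_mul] at hi hbad
    exact ⟨he, hi, hbad⟩
  obtain ⟨k, hk, hmin⟩ :=
    Set.exists_min_image Bad (fun k => (lam k).re) Bad.toFinite ⟨i, hmem⟩
  obtain ⟨l, hl, hlt⟩ := hnext k hk
  exact (hmin l hl).not_gt hlt

/-- Type `C_n` case of the characterization of sufficiently regular weights.
A signed permutation is a pair `(σ, ε)` with `σ` a permutation of `Fin n` and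
`ε` taking values in `{1, -1}`; its difference vector is `i ↦ λ i - ε i * λ (σ i)`. -/
theorem typeC_sufficiently_regular (n : ℕ) (hn : 1 ≤ n) (lam : Fin n → ℂ) :
    (∃ (σ : Equiv.Perm (Fin n)) (ε : Fin n → ℂ),
      (∀ i, ε i = 1 ∨ ε i = -1) ∧
      (∃ i, lam i - ε i * lam (σ i) ≠ 0) ∧
      (∀ i, lam i - ε i * lam (σ i) = 0 ∨ lam i - ε i * lam (σ i) = 1 ∨
        lam i - ε i * lam (σ i) = 2) ∧
      Even (Finset.univ.filter fun i : Fin n => lam i - ε i * lam (σ i) = 1).card) ↔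
    ((∃ i j : Fin n, i ≠ j ∧ (lam i + lam j = 1 ∨ lam i + lam j = 2)) ∨
      ∃ i : Fin n, lam i = 1) := by
  constructor
  · rintro ⟨σ, ε, hε, ⟨i, hi⟩, hv, heven⟩
    by_contra! hcon
    have hpair (i j : Fin n) (h : lam i + lam j = 1 ∨ lam i + lam j = 2) : i = j := by
      by_contra hij
      exact h.elim (hcon.1 i j hij).1 (hcon.1 i j hij).2
    have key := eq_half_of_sub_ne_zero hpair hcon.2 hε hv
    have hcard : (Finset.univ.filter fun i : Fin n => lam i - ε i * lam (σ i) = 1) = {i} := by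
      ext k
      simp only [Finset.mem_filter, Finset.mem_univ, true_and, Finset.mem_singleton]
      constructor
      · intro hk
        have h1 := (key k (by rw [hk]; exact one_ne_zero)).1
        exact hpair k i (Or.inl (by rw [h1, (key i hi).1]; norm_num))
      · rintro rfl
        exact (key k hi).2
    rw [hcard, Finset.card_singleton] at heven
    exact Nat.not_even_one heven
  · rintro (⟨i, j, hij, h⟩ | ⟨i, h⟩)
    · have hv (k : Fin n) : lam k - (if k = i ∨ k = j then -1 else 1) * lam (Equiv.swap i j k) =
          if k = i ∨ k = j then lam i + lam j else 0 := by
        by_cases hki : k = i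
        · subst hki; simp
        · by_cases hkj : k = j
          · subst hkj; simp [add_comm]
          · simp [hki, hkj, Equiv.swap_apply_of_ne_of_ne hki hkj]
      refine ⟨Equiv.swap i j, fun k => if k = i ∨ k = j then -1 else 1, ?_, ⟨i, ?_⟩, ?_, ?_⟩
      · intro k
        dsimp only
        split_ifs <;> simp
      · rw [hv]
        rcases h with h | h <;> simp [h]
      · intro k
        rw [hv]
        split_ifs
        · exact Or.inr h
        · exact Or.inl rfl
      · simp only [hv]
        rcases h with h | h
        · have hs : (Finset.univ.filter fun k : Fin n =>
              (if k = i ∨ k = j then lam i + lam j else 0) = 1) = {i, j} := by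
            ext k
            by_cases hk : k = i <;> simp [h, hk]
          rw [hs, Finset.card_pair hij]
          exact even_two
        · have hs : (Finset.univ.filter fun k : Fin n =>
              (if k = i ∨ k = j then lam i + lam j else 0) = 1) = ∅ := by
            ext k
            by_cases hk : k = i ∨ k = j <;> simp [h, hk]
          rw [hs, Finset.card_empty]
          exact Even.zero
    · have hv (k : Fin n) : lam k - (if k = i then -1 else 1) * lam ((1 : Equiv.Perm (Fin n)) k) =
          if k = i then 2 else 0 := by
        by_cases hk : k = i
        · subst hk; simp [h]; norm_num
        · simp [hk]
      refine ⟨1, fun k => if k = i then -1 else 1, ?_, ⟨i, ?_⟩, ?_, ?_⟩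
      · intro k
        dsimp only
        split_ifs <;> simp
      · rw [hv]
        simp
      · intro k
        rw [hv]
        split_ifs <;> simp
      · simp only [hv]
        have hs : (Finset.univ.filter fun k : Fin n => (if k = i then (2 : ℂ) else 0) = 1) = ∅ := by
          ext k
          by_cases hk : k = i <;> simp [hk]
        rw [hs, Finset.card_empty]
        exact Even.zero
end

section
/- Let n ≥ 2 and λ : {1,…,n} → ℂ. Then the following are equivalent: (a) there exists an even signed permutation (σ, ε) of {1,…,n} whose difference vector v(i) = λ(i) − ε(i)·λ(σ(i)) equals 2·e₁ or equals e₁ + s·e_i for some index 2 ≤ i ≤ n and some sign s ∈ {1, −1}; (b) there exist an index 2 ≤ i ≤ n and a sign s ∈ {1, −1} with λ(1) + s·λ(i) = 1. -/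
/-- A signed permutation preserves the sum of squares; here this is expressed through the
difference vector `v`. -/
theorem sum_two_mul_sub_sq_eq_zero {ι R : Type*} [Fintype ι] [CommRing R]
    (σ : Equiv.Perm ι) {ε lam v : ι → R} (hε : ∀ i, ε i = 1 ∨ ε i = -1)
    (hv : ∀ i, lam i - ε i * lam (σ i) = v i) :
    ∑ i, (2 * lam i * v i - v i ^ 2) = 0 := by
  have hsum : ∑ i, lam (σ i) ^ 2 = ∑ i, lam i ^ 2 := Equiv.sum_comp σ fun i => lam i ^ 2
  rw [← sub_eq_zero.mpr hsum.symm, ← Finset.sum_sub_distrib]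
  refine Finset.sum_congr rfl fun i _ => ?_
  rw [← hv i]
  rcases hε i with h | h <;> rw [h] <;> ring

/-- If an even signed permutation fixes `lam` except for a sign at the single index `z`,
then `lam` vanishes somewhere. -/
theorem exists_eq_zero_of_even_signed_perm {ι R : Type*} [Fintype ι] [DecidableEq ι]
    [CommRing R] [IsDomain R] [CharZero R] (σ : Equiv.Perm ι) {ε lam : ι → R}
    (hprod : ∏ i, ε i = 1) (z : ι) (hz : lam z = -(ε z * lam (σ z)))
    (hne : ∀ i, i ≠ z → lam i = ε i * lam (σ i)) : ∃ i, lam i = 0 := by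
  have hneg : ∏ i, lam i = -∏ i, lam i := by
    calc ∏ i, lam i = ∏ i, (if i = z then -1 else 1) * (ε i * lam (σ i)) := by
          refine Finset.prod_congr rfl fun i _ => ?_
          split_ifs with h
          · rw [h, hz, neg_one_mul]
          · rw [hne i h, one_mul]
      _ = -∏ i, lam i := by
          rw [Finset.prod_mul_distrib, Finset.prod_mul_distrib, hprod, Equiv.prod_comp σ lam]
          simp
  obtain ⟨i, -, hi⟩ := Finset.prod_eq_zero_iff.mp (self_eq_neg.mp hneg)
  exact ⟨i, hi⟩


/-- Type `D_n^ℝ` case of the characterization of sufficiently regular weights.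
Indices `{1, …, n}` are modelled by `Fin n` (zero-based), so the index `1` is
`⟨0, _⟩` and `2 ≤ i ≤ n` becomes `1 ≤ (i : ℕ)`.  An even signed permutation is a
pair `(σ, ε)` with `σ` a permutation, `ε` taking values in `{1, -1}` and
`∏ i, ε i = 1`; its difference vector is `i ↦ λ i - ε i * λ (σ i)`. -/
theorem typeDR_sufficiently_regular (n : ℕ) (hn : 2 ≤ n) (lam : Fin n → ℂ) :
    (∃ (σ : Equiv.Perm (Fin n)) (ε : Fin n → ℂ),
      (∀ i, ε i = 1 ∨ ε i = -1) ∧ (∏ i, ε i) = 1 ∧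
      ((fun i => lam i - ε i * lam (σ i)) =
          (fun i : Fin n => if (i : ℕ) = 0 then (2 : ℂ) else 0) ∨
        ∃ (j : Fin n) (s : ℂ), 1 ≤ (j : ℕ) ∧ (s = 1 ∨ s = -1) ∧
          (fun i => lam i - ε i * lam (σ i)) =
            (fun i : Fin n =>
              (if (i : ℕ) = 0 then (1 : ℂ) else 0) + s * (if i = j then 1 else 0)))) ↔
    (∃ (j : Fin n) (s : ℂ), 1 ≤ (j : ℕ) ∧ (s = 1 ∨ s = -1) ∧
      lam ⟨0, by omega⟩ + s * lam j = 1) := by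
  set z : Fin n := ⟨0, by omega⟩ with hz
  have hval : ∀ i : Fin n, (i : ℕ) = 0 ↔ i = z := fun i => by simp [hz, Fin.ext_iff]
  simp only [hval]
  constructor
  · rintro ⟨σ, ε, hε, hprod, hv | ⟨j, s, hj, hs, hv⟩⟩
    · have hv' := fun i => congrFun hv i
      have hsq := sum_two_mul_sub_sq_eq_zero σ hε hv'
      have hlz : lam z = 1 := by
        rw [Finset.sum_eq_single z (fun i _ hi => by simp [hi]) (by simp), if_pos rfl] at hsq
        linear_combination hsq / 4
      have hvz : lam z - ε z * lam (σ z) = 2 := by simpa using hv' z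
      obtain ⟨j, hj⟩ := exists_eq_zero_of_even_signed_perm σ hprod z
        (by linear_combination 2 * hlz - hvz)
        (fun i hi => sub_eq_zero.mp (by simpa [hi] using hv' i))
      have hjz : j ≠ z := by
        rintro rfl
        simp [hlz] at hj
      exact ⟨j, 1, Nat.one_le_iff_ne_zero.mpr (mt (hval j).mp hjz), Or.inl rfl,
        by rw [hlz, hj]; ring⟩
    · have hjz : j ≠ z := mt (hval j).mpr (by omega)
      have hsq := sum_two_mul_sub_sq_eq_zero σ hε fun i => congrFun hv i
      rw [Fintype.sum_eq_add z j hjz.symm (fun i hi => by simp [hi.1, hi.2])] at hsq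
      simp only [hjz, hjz.symm, if_true, if_false] at hsq
      have hs2 : s ^ 2 = 1 := by rcases hs with rfl | rfl <;> norm_num
      exact ⟨j, s, hj, hs, by linear_combination hsq / 2 + hs2 / 2⟩
  · rintro ⟨j, s, hj, hs, h⟩
    have hjz : j ≠ z := mt (hval j).mpr (by omega)
    have hs2 : s ^ 2 = 1 := by rcases hs with rfl | rfl <;> norm_num
    refine ⟨Equiv.swap z j, fun i => if i = z ∨ i = j then -s else 1, fun i => ?_, ?_,
      Or.inr ⟨j, s, hj, hs, funext fun i => ?_⟩⟩
    · rcases hs with rfl | rfl <;> by_cases hi : i = z ∨ i = j <;> simp [hi]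
    · rw [Fintype.prod_eq_mul z j hjz.symm (fun i hi => by simp [hi.1, hi.2])]
      simp only [true_or, or_true, if_true]
      linear_combination hs2
    · rcases eq_or_ne i z with rfl | hiz
      · simp only [true_or, if_true, Equiv.swap_apply_left, hjz.symm, if_false]
        linear_combination h
      · rcases eq_or_ne i j with rfl | hij
        · simp only [or_true, if_true, Equiv.swap_apply_right, hiz, if_false]
          linear_combination s * h - lam i * hs2
        · simp [hiz, hij, Equiv.swap_apply_of_ne_of_ne hiz hij]
end

section
/- Let n ≥ 2 and λ : {1,…,n} → ℂ. Then the following are equivalent: (a) there exists an even signed permutation (σ, ε) of {1,…,n} whose difference vector v(i) = λ(i) − ε(i)·λ(σ(i)) satisfies v(i) ∈ {0, 1} for all i and the number of indices i with v(i) = 1 is even and positive; (b) there exist distinct indices i ≠ j with λ(i) + λ(j) = 1. -/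
open scoped Classical

/-- Indicator function of the progression `a, a + 1, a + 2, …`. -/
noncomputable def progressionIndicator (a x : ℂ) : ℤ :=
  if ∃ k : ℕ, x = a + k then 1 else 0

lemma progressionIndicator_sub_one (a x : ℂ) :
    progressionIndicator a (x - 1) = progressionIndicator a x - if x = a then 1 else 0 := by
  unfold progressionIndicator
  have hsub : (∃ k : ℕ, x - 1 = a + k) ↔ ∃ k : ℕ, x = a + (k + 1 : ℕ) := by
    refine exists_congr fun k => ?_
    push_cast
    constructor <;> intro h <;> linear_combination h
  have hiff : (∃ k : ℕ, x = a + k) ↔ x = a ∨ ∃ k : ℕ, x = a + (k + 1 : ℕ) := by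
    constructor
    · rintro ⟨_ | k, hk⟩
      · left; simpa using hk
      · exact .inr ⟨k, hk⟩
    · rintro (h | ⟨k, hk⟩)
      · exact ⟨0, by simpa using h⟩
      · exact ⟨k + 1, hk⟩
  have hdisj : x = a → ¬ ∃ k : ℕ, x = a + (k + 1 : ℕ) := by
    rintro rfl ⟨k, hk⟩
    have h0 : ((k + 1 : ℕ) : ℂ) = 0 := by linear_combination -hk
    exact Nat.succ_ne_zero k (by exact_mod_cast h0)
  rw [if_congr hsub rfl rfl, if_congr hiff rfl rfl]
  by_cases h : x = a
  · rw [if_neg (hdisj h)]; simp [h]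
  · simp [h]

/-- The symmetrized indicator of the progression `a, a + 1, a + 2, …`. -/
noncomputable def evenProgressionIndicator (a x : ℂ) : ℤ :=
  progressionIndicator a x + progressionIndicator a (-x)

lemma evenProgressionIndicator_neg (a x : ℂ) :
    evenProgressionIndicator a (-x) = evenProgressionIndicator a x := by
  simp [evenProgressionIndicator, add_comm]

lemma evenProgressionIndicator_sub_one (a x : ℂ) :
    evenProgressionIndicator a (x - 1) = evenProgressionIndicator a x
      + (if x + a = 1 then 1 else 0) - if x = a then 1 else 0 := by
  have h := progressionIndicator_sub_one a (1 - x)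
  have hiff : 1 - x = a ↔ x + a = 1 := by
    constructor <;> intro h <;> linear_combination -h
  rw [if_congr hiff rfl rfl, show 1 - x - 1 = -x by ring] at h
  unfold evenProgressionIndicator
  rw [progressionIndicator_sub_one, h, neg_sub]
  ring

/-- If a signed permutation moves `lam` by a vector with entries in `{0, 1}`, then every entry
that is moved by `1` has a partner, also moved by `1`, such that the two entries sum to `1`. -/
lemma exists_add_eq_one_of_signedPerm {ι : Type*} [Fintype ι] (lam : ι → ℂ)
    (σ : Equiv.Perm ι) (ε : ι → ℂ) (hε : ∀ i, ε i = 1 ∨ ε i = -1)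
    (hv : ∀ i, lam i - ε i * lam (σ i) = 0 ∨ lam i - ε i * lam (σ i) = 1)
    (i : ι) (hi : lam i - ε i * lam (σ i) = 1) :
    ∃ j, lam j - ε j * lam (σ j) = 1 ∧ lam j + lam i = 1 := by
  by_contra! hno
  set f := evenProgressionIndicator (lam i)
  have hsign (j : ι) : f (ε j * lam (σ j)) = f (lam (σ j)) := by
    rcases hε j with h | h
    · rw [h, one_mul]
    · rw [h, neg_one_mul]
      exact evenProgressionIndicator_neg _ _
  have hsum : ∑ j, f (ε j * lam (σ j)) = ∑ j, f (lam j) := by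
    simp_rw [hsign]
    exact Equiv.sum_comp σ fun j => f (lam j)
  have hmoved (j : ι) (hj : lam j - ε j * lam (σ j) = 1) :
      f (ε j * lam (σ j)) = f (lam j) - if lam j = lam i then 1 else 0 := by
    rw [show ε j * lam (σ j) = lam j - 1 by linear_combination -hj]
    have h := evenProgressionIndicator_sub_one (lam i) (lam j)
    rwa [if_neg (hno j hj), add_zero] at h
  refine hsum.not_lt (Finset.sum_lt_sum (fun j _ => ?_) ⟨i, Finset.mem_univ i, ?_⟩)
  · rcases hv j with hj | hj
    · rw [sub_eq_zero.mp hj]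
    · rw [hmoved j hj]
      split_ifs <;> omega
  · rw [hmoved i hi, if_pos rfl]
    omega

/-- Type `D_n^ℍ` case of the characterization of sufficiently regular weights.
An even signed permutation is a pair `(σ, ε)` with `σ` a permutation of `Fin n`,
`ε` taking values in `{1, -1}` and `∏ i, ε i = 1`; its difference vector is
`i ↦ λ i - ε i * λ (σ i)`. -/
theorem typeDH_sufficiently_regular (n : ℕ) (hn : 2 ≤ n) (lam : Fin n → ℂ) :
    (∃ (σ : Equiv.Perm (Fin n)) (ε : Fin n → ℂ),
      (∀ i, ε i = 1 ∨ ε i = -1) ∧ (∏ i, ε i) = 1 ∧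
      (∀ i, lam i - ε i * lam (σ i) = 0 ∨ lam i - ε i * lam (σ i) = 1) ∧
      Even (Finset.univ.filter fun i : Fin n => lam i - ε i * lam (σ i) = 1).card ∧
      0 < (Finset.univ.filter fun i : Fin n => lam i - ε i * lam (σ i) = 1).card) ↔
    ∃ i j : Fin n, i ≠ j ∧ lam i + lam j = 1 := by
  constructor
  · rintro ⟨σ, ε, hε, -, hv, heven, hpos⟩
    have hcard : 1 < (Finset.univ.filter fun i : Fin n => lam i - ε i * lam (σ i) = 1).card := by
      obtain ⟨k, hk⟩ := heven
      omega
    obtain ⟨i, hi, j, hj, hij⟩ := Finset.one_lt_card.mp hcard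
    obtain ⟨i', -, hi'⟩ :=
      exists_add_eq_one_of_signedPerm lam σ ε hε hv i (Finset.mem_filter.mp hi).2
    obtain ⟨j', -, hj'⟩ :=
      exists_add_eq_one_of_signedPerm lam σ ε hε hv j (Finset.mem_filter.mp hj).2
    by_cases hii : i' = i
    · by_cases hjj : j' = j
      · subst hii hjj
        exact ⟨i', j', hij, by linear_combination (hi' + hj') / 2⟩
      · exact ⟨j', j, hjj, hj'⟩
    · exact ⟨i', i, hii, hi'⟩
  · rintro ⟨i, j, hij, hsum⟩
    set ε : Fin n → ℂ := fun k => if k ∈ ({i, j} : Finset (Fin n)) then -1 else 1 with hε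
    have hmem (k : Fin n) (hk : k ∈ ({i, j} : Finset (Fin n))) :
        lam k - ε k * lam (Equiv.swap i j k) = 1 := by
      rw [hε]
      simp only [if_pos hk]
      rcases Finset.mem_insert.mp hk with rfl | hk
      · rw [Equiv.swap_apply_left]
        linear_combination hsum
      · rw [Finset.mem_singleton.mp hk, Equiv.swap_apply_right]
        linear_combination hsum
    have hnotMem (k : Fin n) (hk : k ∉ ({i, j} : Finset (Fin n))) :
        lam k - ε k * lam (Equiv.swap i j k) = 0 := by
      rw [hε]
      simp only [if_neg hk]
      simp only [Finset.mem_insert, Finset.mem_singleton, not_or] at hk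
      rw [Equiv.swap_apply_of_ne_of_ne hk.1 hk.2]
      ring
    have hfilter : (Finset.univ.filter fun k : Fin n =>
        lam k - ε k * lam (Equiv.swap i j k) = 1) = {i, j} := by
      ext k
      rw [Finset.mem_filter_univ]
      refine ⟨fun h => ?_, hmem k⟩
      by_contra hk
      exact zero_ne_one ((hnotMem k hk).symm.trans h)
    refine ⟨Equiv.swap i j, ε, fun k => ?_, ?_, fun k => ?_, ?_, ?_⟩
    · rw [hε]
      dsimp only
      split_ifs <;> simp
    · rw [hε, Finset.prod_ite_mem, Finset.univ_inter, Finset.prod_pair hij]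
      norm_num
    · by_cases hk : k ∈ ({i, j} : Finset (Fin n))
      · exact .inr (hmem k hk)
      · exact .inl (hnotMem k hk)
    · rw [hfilter, Finset.card_pair hij]
      exact even_two
    · rw [hfilter, Finset.card_pair hij]
      exact two_pos
end

section
/- Suppose: (i) μ₀ ∈ V is fixed by every element of W_m; (ii) Ω ⊆ V is a W-stable subset containing μ₀; (iii) S ⊆ V is a set on which W_m acts transitivity, i.e., for all α, β ∈ S there exists w ∈ W_m with w(α) = β; (iv) there exist α₀ ∈ S and μ₀'' ∈ Ω with μ₀'' ≠ μ₀, α₀ = μ₀ − μ₀'', B(α₀, α₀) ≠ 0, and the reflection s_{α₀} belongs to W. Then for every λ ∈ V: if there exists α ∈ S with 2·B(λ, α) = B(α, α), then there exist w ∈ W and μ' ∈ Ω with μ' ≠ μ₀ and λ − w(λ) = μ₀ − μ'. -/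
/-- Abstract form of the "if" part of the key observation (Lemma 4.2.2 style):
if `W_m` acts transitively on `S`, `μ₀` is `W_m`-fixed, `Ω` is `W`-stable and
contains `μ₀`, and there is a base root `α₀ ∈ S` of the form `μ₀ - μ₀''` with
`μ₀'' ∈ Ω`, `μ₀'' ≠ μ₀`, whose reflection lies in `W`, then any `λ` pairing to
`1` against the coroot of some `α ∈ S` (i.e. `2 B(λ, α) = B(α, α)`) satisfies
`λ - w(λ) = μ₀ - μ'` for some `w ∈ W` and some `μ' ∈ Ω` with `μ' ≠ μ₀`. -/
theorem reflection_translation_of_pairing_one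
    {V : Type*} [AddCommGroup V] [Module ℂ V]
    (B : V →ₗ[ℂ] V →ₗ[ℂ] ℂ)
    (hsymm : ∀ x y : V, B x y = B y x)
    (W Wm : Subgroup (V ≃ₗ[ℂ] V)) (hWm : Wm ≤ W)
    (hBW : ∀ w ∈ W, ∀ x y : V, B (w x) (w y) = B x y)
    (μ₀ : V) (Ω S : Set V)
    (hfix : ∀ w ∈ Wm, w μ₀ = μ₀)
    (hμ₀Ω : μ₀ ∈ Ω)
    (hΩstable : ∀ w ∈ W, ∀ x ∈ Ω, w x ∈ Ω)
    (htrans : ∀ α ∈ S, ∀ β ∈ S, ∃ w ∈ Wm, w α = β)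
    (hbase : ∃ α₀ ∈ S, ∃ μ₀'' ∈ Ω, μ₀'' ≠ μ₀ ∧ α₀ = μ₀ - μ₀'' ∧ B α₀ α₀ ≠ 0 ∧
      ∃ w ∈ W, ∀ x : V, w x = x - (2 * B x α₀ / B α₀ α₀) • α₀)
    (lam : V) (hlam : ∃ α ∈ S, 2 * B lam α = B α α) :
    ∃ w ∈ W, ∃ μ' ∈ Ω, μ' ≠ μ₀ ∧ lam - w lam = μ₀ - μ' := by
  obtain ⟨α₀, hα₀, μ₁, hμ₁, hne, hα₀_eq, hnz, s, hs, hs_apply⟩ := hbase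
  obtain ⟨α, hα, hpair⟩ := hlam
  obtain ⟨u, hu, rfl⟩ := htrans α₀ hα₀ α hα
  have huW := hWm hu
  have hu_inv : u (u⁻¹ lam) = lam := u.apply_symm_apply lam
  have hpair' : 2 * B (u⁻¹ lam) α₀ = B α₀ α₀ := by
    rw [← hBW u huW (u⁻¹ lam) α₀, hu_inv, hpair, hBW u huW]
  refine ⟨u * s * u⁻¹, W.mul_mem (W.mul_mem huW hs) (W.inv_mem huW), u μ₁,
    hΩstable u huW μ₁ hμ₁, fun h => hne (u.injective (h.trans (hfix u hu).symm)), ?_⟩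
  rw [LinearEquiv.mul_apply, LinearEquiv.mul_apply, hs_apply, hpair', div_self hnz, one_smul,
    map_sub, hu_inv, sub_sub_cancel, hα₀_eq, map_sub, hfix u hu]
end

section
/- For every λ ∈ ℂ^6 the following are equivalent: (a) there exist w ∈ W and μ' in the W-orbit of ϖ₆ with μ' ≠ ϖ₆ such that λ − w(λ) = ϖ₆ − μ'; (b) there exists α ∈ N with B(λ, α) = 1. -/
open scoped Classical

/-- The standard symmetric bilinear form on `ℂ^6`. -/
noncomputable def B6 (x y : Fin 6 → ℂ) : ℂ := ∑ i, x i * y i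

/-- The root system of type `E₆` in the coordinates of the paper:
`±e_i ± e_j` for `1 ≤ i < j ≤ 5` (zero-based: `i < j`, `(j : ℕ) < 5`), together with
`(ε₁/2, …, ε₅/2, ε·√3/2)` with `ε₁, …, ε₅, ε ∈ {1, -1}` and an odd number of `+1`'s. -/
noncomputable def PhiE6 : Set (Fin 6 → ℂ) :=
  {α | (∃ (i j : Fin 6) (s t : ℂ), (i : ℕ) < (j : ℕ) ∧ (j : ℕ) < 5 ∧
        (s = 1 ∨ s = -1) ∧ (t = 1 ∨ t = -1) ∧
        α = fun k => (if k = i then s else 0) + (if k = j then t else 0)) ∨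
      (∃ ε : Fin 6 → ℂ, (∀ k, ε k = 1 ∨ ε k = -1) ∧
        Odd (Finset.univ.filter fun k : Fin 6 => ε k = 1).card ∧
        α = fun k : Fin 6 => if (k : ℕ) = 5 then ε k * ((Real.sqrt 3 / 2 : ℝ) : ℂ)
          else ε k / 2)}

/-- The minuscule fundamental weight `ϖ₆ = (0, 0, 0, 0, 0, 2/√3)`. -/
noncomputable def varpiE6 : Fin 6 → ℂ :=
  fun k => if (k : ℕ) = 5 then ((2 / Real.sqrt 3 : ℝ) : ℂ) else 0

/-- The Weyl group of `E₆`: the subgroup of linear automorphisms of `ℂ^6` generated by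
the reflections `s_α : x ↦ x - B(x, α)·α` for `α ∈ Φ` (all roots have `B(α,α) = 2`). -/
noncomputable def WE6 : Subgroup ((Fin 6 → ℂ) ≃ₗ[ℂ] (Fin 6 → ℂ)) :=
  Subgroup.closure
    {w : (Fin 6 → ℂ) ≃ₗ[ℂ] (Fin 6 → ℂ) | ∃ α ∈ PhiE6, ∀ x, w x = x - B6 x α • α}

/-- The roots of `𝔫^std`: the roots `α` with `B(ϖ₆, α) = 1`. -/
noncomputable def NE6 : Set (Fin 6 → ℂ) := {α | α ∈ PhiE6 ∧ B6 varpiE6 α = 1}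

lemma sqrt_three_sq : ((Real.sqrt 3 : ℝ) : ℂ) ^ 2 = 3 := by
  rw [← Complex.ofReal_pow, Real.sq_sqrt (by norm_num)]; norm_num

lemma sqrt_three_ne_zero : ((Real.sqrt 3 : ℝ) : ℂ) ≠ 0 := by
  intro h
  have := sqrt_three_sq
  simp [h] at this

/-- The vector `(b₀/2, …, b₄/2, b₅·√3/2)` with half-integral coordinates. -/
noncomputable def halfVec (b : Fin 6 → ℤ) : Fin 6 → ℂ :=
  fun k => if (k : ℕ) = 5 then (b k : ℂ) * ((Real.sqrt 3 / 2 : ℝ) : ℂ) else (b k : ℂ) / 2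

/-- The half-integral coordinates of vectors of the root lattice of `E₆`. -/
def IsRootLattice (b : Fin 6 → ℤ) : Prop := (∀ i, 2 ∣ b i - b 5) ∧ 4 ∣ ∑ i, b i

/-- The invariant quintic of the Weyl group of `E₆`, proportional to the sum of the fifth powers
of the `27` weights of the minuscule representation. -/
noncomputable def quintic (x : Fin 6 → ℂ) : ℂ :=
  let y := x 5 / ((Real.sqrt 3 : ℝ) : ℂ)
  8 * ∏ i : Fin 5, x i.castSucc + y * ((∑ i : Fin 5, x i.castSucc ^ 2) ^ 2
    - 2 * ∑ i : Fin 5, x i.castSucc ^ 4 - 2 * y ^ 2 * ∑ i : Fin 5, x i.castSucc ^ 2 + 3 * y ^ 4)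

lemma B6_halfVec_right (x : Fin 6 → ℂ) (b : Fin 6 → ℤ) :
    B6 x (halfVec b) = ((∑ i : Fin 5, x i.castSucc * b i.castSucc) +
      3 * (x 5 / ((Real.sqrt 3 : ℝ) : ℂ)) * b 5) / 2 := by
  have h := sqrt_three_sq
  have h0 := sqrt_three_ne_zero
  simp [B6, halfVec, Fin.sum_univ_castSucc]
  field_simp
  linear_combination x 5 * b 5 * h

lemma halfVec_castSucc (b : Fin 6 → ℤ) (i : Fin 5) :
    halfVec b i.castSucc = (b i.castSucc : ℂ) / 2 := by
  have : (i : ℕ) ≠ 5 := by omega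
  simp [halfVec, this]

lemma halfVec_five_div (b : Fin 6 → ℤ) :
    halfVec b 5 / ((Real.sqrt 3 : ℝ) : ℂ) = (b 5 : ℂ) / 2 := by
  have h0 := sqrt_three_ne_zero
  simp [halfVec]
  field_simp

lemma varpiE6_castSucc (i : Fin 5) : varpiE6 i.castSucc = 0 := by
  have : (i : ℕ) ≠ 5 := by omega
  simp [varpiE6, this]

lemma varpiE6_five_div : varpiE6 5 / ((Real.sqrt 3 : ℝ) : ℂ) = 2 / 3 := by
  rw [← sqrt_three_sq]
  simp [varpiE6]
  ring

lemma B6_varpiE6_halfVec (b : Fin 6 → ℤ) : B6 varpiE6 (halfVec b) = b 5 := by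
  simp only [B6_halfVec_right, varpiE6_castSucc, varpiE6_five_div]
  simp
  ring

lemma B6_halfVec_halfVec (a b : Fin 6 → ℤ) :
    B6 (halfVec a) (halfVec b) =
      ((∑ i : Fin 5, a i.castSucc * b i.castSucc : ℤ) + 3 * (a 5 : ℂ) * b 5) / 4 := by
  simp only [B6_halfVec_right, halfVec_castSucc, halfVec_five_div]
  push_cast
  simp only [Fin.sum_univ_five]
  ring

lemma sum_eq_of_signs {ε : Fin 6 → ℤ} (hε : ∀ k, ε k = 1 ∨ ε k = -1) :
    ∑ k, ε k = 2 * (Finset.univ.filter fun k => ε k = 1).card - 6 := by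
  have h : ∀ k, ε k = 2 * (if ε k = 1 then 1 else 0) - 1 := fun k => by
    rcases hε k with h | h <;> simp [h]
  rw [Finset.sum_congr rfl fun k _ => h k, Finset.sum_sub_distrib, ← Finset.mul_sum]
  simp

lemma halfVec_mem_PhiE6 {ε : Fin 6 → ℤ} (hε : ∀ k, ε k = 1 ∨ ε k = -1) (h4 : 4 ∣ ∑ k, ε k) :
    halfVec ε ∈ PhiE6 := by
  refine Or.inr ⟨fun k => ε k, fun k => ?_, ?_, rfl⟩
  · rcases hε k with h | h <;> simp [h]
  · rw [sum_eq_of_signs hε] at h4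
    simp only [Int.cast_eq_one]
    rw [Nat.odd_iff]
    omega

/-- A root is either `±eᵢ ± eⱼ` or has half-odd coordinates of the right parity. -/
lemma exists_eq_halfVec_of_mem_PhiE6 {α : Fin 6 → ℂ} (hα : α ∈ PhiE6) :
    (∃ i j : Fin 5, i < j ∧ ∃ s t : ℤ, (s = 1 ∨ s = -1) ∧ (t = 1 ∨ t = -1) ∧
      α = halfVec (2 • (Pi.single i.castSucc s + Pi.single j.castSucc t))) ∨
    ∃ ε : Fin 6 → ℤ, (∀ k, ε k = 1 ∨ ε k = -1) ∧ 4 ∣ ∑ k, ε k ∧ α = halfVec ε := by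
  rcases hα with ⟨i, j, s, t, hij, hj, hs, ht, rfl⟩ | ⟨ε, hε, hodd, rfl⟩
  · left
    refine ⟨⟨i, by omega⟩, ⟨j, hj⟩, by simpa using hij, if s = 1 then 1 else -1,
      if t = 1 then 1 else -1, by split_ifs <;> simp, by split_ifs <;> simp, ?_⟩
    have hs' : s = ((if s = 1 then 1 else -1 : ℤ) : ℂ) := by rcases hs with rfl | rfl <;> norm_num
    have ht' : t = ((if t = 1 then 1 else -1 : ℤ) : ℂ) := by rcases ht with rfl | rfl <;> norm_num
    generalize (if s = 1 then 1 else -1 : ℤ) = s' at hs'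
    generalize (if t = 1 then 1 else -1 : ℤ) = t' at ht'
    subst hs' ht'
    ext k
    have hi : (⟨i, by omega⟩ : Fin 5).castSucc = i := rfl
    have hj' : (⟨j, hj⟩ : Fin 5).castSucc = j := rfl
    rw [hi, hj']
    by_cases hk : (k : ℕ) = 5
    · have h1 : k ≠ i := by rintro rfl; omega
      have h2 : k ≠ j := by rintro rfl; omega
      simp [halfVec, h1, h2]
    · simp [halfVec, hk, Pi.single_apply]
  · right
    have h : ∀ k, ε k = ((if ε k = 1 then 1 else -1 : ℤ) : ℂ) := fun k => by
      rcases hε k with h | h <;> norm_num [h]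
    have hs : ∀ k, (if ε k = 1 then 1 else -1 : ℤ) = 1 ∨ (if ε k = 1 then 1 else -1 : ℤ) = -1 :=
      fun k => by split_ifs <;> simp
    refine ⟨fun k => if ε k = 1 then 1 else -1, hs, ?_, ?_⟩
    · rw [sum_eq_of_signs hs]
      have : (Finset.univ.filter fun k => (if ε k = 1 then 1 else -1 : ℤ) = 1) =
          Finset.univ.filter fun k => ε k = 1 := by
        ext k; by_cases hk : ε k = 1 <;> simp [hk]
      rw [this]
      obtain ⟨m, hm⟩ := hodd
      omega
    · ext k
      simp only [halfVec, ← h]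

/-- Roots are root lattice vectors of norm two. -/
lemma exists_isRootLattice_of_mem_PhiE6 {α : Fin 6 → ℂ} (hα : α ∈ PhiE6) :
    ∃ b, IsRootLattice b ∧ α = halfVec b ∧ B6 α α = 2 := by
  rcases exists_eq_halfVec_of_mem_PhiE6 hα with ⟨i, j, hij, s, t, hs, ht, rfl⟩ | ⟨ε, hε, h4, rfl⟩
  · refine ⟨_, ⟨fun k => ?_, ?_⟩, rfl, ?_⟩
    · simp only [Pi.smul_apply, ← smul_sub]
      simp
    · simp only [Pi.smul_apply, ← Finset.smul_sum, Pi.add_apply, Finset.sum_add_distrib,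
        Finset.sum_pi_single', Finset.mem_univ, if_true]
      rcases hs with rfl | rfl <;> rcases ht with rfl | rfl <;> simp
    · rw [B6_halfVec_halfVec]
      rcases hs with rfl | rfl <;> rcases ht with rfl | rfl <;> fin_cases i <;> fin_cases j <;>
        simp [Fin.sum_univ_five, Pi.single_apply] at hij ⊢ <;> norm_num
  · refine ⟨ε, ⟨fun k => ?_, h4⟩, rfl, ?_⟩
    · rcases hε k with h | h <;> rcases hε 5 with h' | h' <;> simp [h, h']
    · have h : ∀ k, (ε k : ℂ) * ε k = 1 := fun k => by rcases hε k with h | h <;> simp [h]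
      rw [B6_halfVec_halfVec, mul_assoc, h]
      push_cast
      simp only [h]
      norm_num

lemma IsRootLattice.add_smul {a b : Fin 6 → ℤ} (ha : IsRootLattice a) (hb : IsRootLattice b)
    (m : ℤ) : IsRootLattice (a + m • b) := by
  refine ⟨fun i => ?_, ?_⟩
  · rw [show (a + m • b) i - (a + m • b) 5 = (a i - a 5) + m * (b i - b 5) by
      simp only [Pi.add_apply, Pi.smul_apply, smul_eq_mul]; ring]
    exact dvd_add (ha.1 i) ((hb.1 i).mul_left m)
  · simp only [Pi.add_apply, Pi.smul_apply, Finset.sum_add_distrib, ← Finset.smul_sum]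
    exact dvd_add ha.2 (hb.2.mul_left m)

lemma IsRootLattice.exists_B6_eq_intCast {a b : Fin 6 → ℤ} (ha : IsRootLattice a)
    (hb : IsRootLattice b) : ∃ m : ℤ, B6 (halfVec a) (halfVec b) = m := by
  obtain ⟨ha, ha4⟩ := ha
  obtain ⟨hb, hb4⟩ := hb
  choose c hc using ha
  choose d hd using hb
  obtain ⟨p, hp⟩ := ha4
  obtain ⟨q, hq⟩ := hb4
  have hca : ∀ i : Fin 5, a i.castSucc = a 5 + 2 * c i.castSucc := fun i => by
    linarith [hc i.castSucc]
  have hdb : ∀ i : Fin 5, b i.castSucc = b 5 + 2 * d i.castSucc := fun i => by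
    linarith [hd i.castSucc]
  have key : (∑ i : Fin 5, a i.castSucc * b i.castSucc) + 3 * a 5 * b 5 =
      4 * (b 5 * p + a 5 * q - a 5 * b 5 + ∑ i : Fin 5, c i.castSucc * d i.castSucc) := by
    rw [Fin.sum_univ_castSucc] at hp hq
    simp only [hca, hdb] at hp hq ⊢
    simp only [Fin.sum_univ_five, Fin.reduceLast] at *
    linear_combination b 5 * hp + a 5 * hq
  refine ⟨b 5 * p + a 5 * q - a 5 * b 5 + ∑ i : Fin 5, c i.castSucc * d i.castSucc, ?_⟩
  rw [B6_halfVec_halfVec, div_eq_iff (by norm_num), mul_comm _ (4 : ℂ)]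
  exact_mod_cast key

lemma B6_sub_smul_self {x α : Fin 6 → ℂ} (hα : B6 α α = 2) :
    B6 (x - B6 x α • α) (x - B6 x α • α) = B6 x x := by
  simp only [B6, Pi.sub_apply, Pi.smul_apply, smul_eq_mul, Fin.sum_univ_six] at *
  linear_combination
    (x 0 * α 0 + x 1 * α 1 + x 2 * α 2 + x 3 * α 3 + x 4 * α 4 + x 5 * α 5) ^ 2 * hα

lemma B6_sub_smul_left {x α : Fin 6 → ℂ} (c : ℂ) (v : Fin 6 → ℂ) :
    B6 (x - c • α) v = B6 x v - c * B6 α v := by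
  simp only [B6, Pi.sub_apply, Pi.smul_apply, smul_eq_mul, Fin.sum_univ_six]
  ring

lemma quintic_reflection_halfVec_of_signs (x : Fin 6 → ℂ) {ε : Fin 6 → ℤ}
    (hε : ∀ k, ε k = 1 ∨ ε k = -1) (h4 : 4 ∣ ∑ k, ε k) :
    quintic (x - B6 x (halfVec ε) • halfVec ε) = quintic x := by
  have hprod : ε 0 * ε 1 * ε 2 * ε 3 * ε 4 = -ε 5 := by
    rw [Fin.sum_univ_six] at h4
    rcases hε 0 with h0 | h0 <;> rcases hε 1 with h1 | h1 <;> rcases hε 2 with h2 | h2 <;>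
      rcases hε 3 with h3 | h3 <;> rcases hε 4 with h | h <;> rcases hε 5 with h5 | h5 <;>
      rw [h0, h1, h2, h3, h, h5] at h4 ⊢ <;> revert h4 <;> decide
  have hprod' : (ε 0 * ε 1 * ε 2 * ε 3 * ε 4 : ℂ) = -ε 5 := by exact_mod_cast hprod
  have hsq : ∀ k, (ε k : ℂ) ^ 2 = 1 := fun k => by rcases hε k with h | h <;> simp [h]
  have hsq4 : ∀ k, (ε k : ℂ) ^ 4 = 1 := fun k => by
    rw [show 4 = 2 * 2 from rfl, pow_mul, hsq, one_pow]
  obtain ⟨z, hz⟩ : ∃ z : Fin 5 → ℂ, ∀ i, x i.castSucc = ε i.castSucc * z i :=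
    ⟨fun i => ε i.castSucc * x i.castSucc, fun i => by linear_combination -x i.castSucc * hsq _⟩
  obtain ⟨y, hy⟩ : ∃ y : ℂ, x 5 / ((Real.sqrt 3 : ℝ) : ℂ) = ε 5 * y :=
    ⟨ε 5 * (x 5 / ((Real.sqrt 3 : ℝ) : ℂ)), by
      linear_combination -(x 5 / ((Real.sqrt 3 : ℝ) : ℂ)) * hsq 5⟩
  have form : ∀ (x : Fin 6 → ℂ) (z : Fin 5 → ℂ) (y : ℂ),
      (∀ i, x i.castSucc = ε i.castSucc * z i) → x 5 / ((Real.sqrt 3 : ℝ) : ℂ) = ε 5 * y →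
      quintic x = ε 5 * (-8 * ∏ i, z i + y * ((∑ i, z i ^ 2) ^ 2 - 2 * ∑ i, z i ^ 4
        - 2 * y ^ 2 * ∑ i, z i ^ 2 + 3 * y ^ 4)) := by
    intro x z y hz hy
    simp only [quintic, hz, hy, mul_pow, hsq, hsq4, one_mul, Finset.prod_mul_distrib]
    have : (∏ i : Fin 5, (ε i.castSucc : ℂ)) = -ε 5 := by
      rw [Fin.prod_univ_five]; exact hprod'
    rw [this]
    ring
  have hB : B6 x (halfVec ε) = ((∑ i, z i) + 3 * y) / 2 := by
    rw [B6_halfVec_right, hy]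
    simp only [hz]
    rw [Finset.sum_congr rfl fun i _ => show (ε i.castSucc * z i * ε i.castSucc : ℂ) = z i by
      linear_combination z i * hsq _]
    linear_combination 3 * y / 2 * hsq 5
  rw [form x z y hz hy, hB]
  rw [form _ (fun i => z i - ((∑ i, z i) + 3 * y) / 4) (y - ((∑ i, z i) + 3 * y) / 4)]
  · simp only [Fin.sum_univ_five, Fin.prod_univ_five]
    ring
  · intro i
    simp only [Pi.sub_apply, Pi.smul_apply, smul_eq_mul, halfVec_castSucc, hz]
    ring
  · simp only [Pi.sub_apply, Pi.smul_apply, smul_eq_mul, sub_div, mul_div_assoc, halfVec_five_div,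
      hy]
    ring

lemma quintic_reflection {x α : Fin 6 → ℂ} (hα : α ∈ PhiE6) :
    quintic (x - B6 x α • α) = quintic x := by
  rcases exists_eq_halfVec_of_mem_PhiE6 hα with ⟨i, j, hij, s, t, hs, ht, rfl⟩ | ⟨ε, hε, h4, rfl⟩
  · rw [B6_halfVec_right]
    simp only [quintic, Pi.sub_apply, Pi.smul_apply, smul_eq_mul, sub_div, mul_div_assoc,
      halfVec_five_div, halfVec_castSucc]
    rcases hs with rfl | rfl <;> rcases ht with rfl | rfl <;> fin_cases i <;> fin_cases j <;>
      simp [Fin.sum_univ_five, Fin.prod_univ_five, Pi.single_apply] at hij ⊢ <;> ring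
  · exact quintic_reflection_halfVec_of_signs x hε h4

/-- A function invariant under all reflections is invariant under the Weyl group. -/
lemma apply_eq_of_mem_WE6 {β : Type*} {f : (Fin 6 → ℂ) → β}
    (hf : ∀ α ∈ PhiE6, ∀ x, f (x - B6 x α • α) = f x) {w : (Fin 6 → ℂ) ≃ₗ[ℂ] (Fin 6 → ℂ)}
    (hw : w ∈ WE6) (x : Fin 6 → ℂ) : f (w x) = f x := by
  induction hw using Subgroup.closure_induction generalizing x with
  | mem w hw =>
    obtain ⟨α, hα, hw⟩ := hw
    rw [hw, hf α hα]
  | one => rfl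
  | mul u v _ _ hu hv => rw [LinearEquiv.mul_apply, hu, hv]
  | inv u _ hu =>
    rw [← hu]
    exact congrArg f (u.apply_symm_apply x)

lemma halfVec_add_smul (a b : Fin 6 → ℤ) (m : ℤ) :
    halfVec (a + m • b) = halfVec a + (m : ℂ) • halfVec b := by
  ext k
  by_cases hk : (k : ℕ) = 5 <;> simp [halfVec, hk] <;> ring

/-- The Weyl orbit of `ϖ₆` lies in the coset `ϖ₆ + Q` of the root lattice `Q`. -/
lemma exists_isRootLattice_of_mem_WE6 {u : (Fin 6 → ℂ) ≃ₗ[ℂ] (Fin 6 → ℂ)} (hu : u ∈ WE6) :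
    ∃ a, IsRootLattice a ∧ varpiE6 - u varpiE6 = halfVec a := by
  let P : (Fin 6 → ℂ) → Prop := fun x => ∃ a, IsRootLattice a ∧ varpiE6 - x = halfVec a
  have step : ∀ α ∈ PhiE6, ∀ x, P x → P (x - B6 x α • α) := by
    rintro α hα x ⟨a, ha, hx⟩
    obtain ⟨b, hb, rfl, -⟩ := exists_isRootLattice_of_mem_PhiE6 hα
    obtain ⟨m, hm⟩ := ha.exists_B6_eq_intCast hb
    refine ⟨a + (b 5 - m) • b, ha.add_smul hb _, ?_⟩
    have hx' : x = varpiE6 - (1 : ℂ) • halfVec a := by rw [one_smul, ← hx, sub_sub_cancel]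
    have hB : B6 x (halfVec b) = ((b 5 - m : ℤ) : ℂ) := by
      rw [hx', B6_sub_smul_left, hm, B6_varpiE6_halfVec]
      push_cast
      ring
    rw [halfVec_add_smul, hB, ← hx]
    abel
  have hf : ∀ α ∈ PhiE6, ∀ x, P (x - B6 x α • α) = P x := by
    refine fun α hα x => propext ⟨fun h => ?_, step α hα x⟩
    have h2 := step α hα _ h
    obtain ⟨-, -, -, hα2⟩ := exists_isRootLattice_of_mem_PhiE6 hα
    rw [B6_sub_smul_left, hα2, sub_sub, ← add_smul,
      show B6 x α + (B6 x α - B6 x α * 2) = 0 by ring, zero_smul, sub_zero] at h2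
    exact h2
  have h0 : P varpiE6 := by
    refine ⟨0, ⟨by simp, by simp⟩, ?_⟩
    ext k
    simp [halfVec]
  exact (apply_eq_of_mem_WE6 hf hu varpiE6).mpr h0

lemma eq_zero_or_one_or_two_of_norm {a : Fin 6 → ℤ}
    (hn : 3 * ∑ i : Fin 5, a i.castSucc ^ 2 + (4 - 3 * a 5) ^ 2 = 16) :
    a 5 = 0 ∨ a 5 = 1 ∨ a 5 = 2 := by
  have h0 : 0 ≤ ∑ i : Fin 5, a i.castSucc ^ 2 := Finset.sum_nonneg fun i _ => sq_nonneg _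
  have h1 : 0 ≤ a 5 := by nlinarith
  have h2 : a 5 < 3 := by nlinarith
  omega

lemma exists_single_of_sum_sq_eq_one {c : Fin 5 → ℤ} (h : ∑ i, c i ^ 2 = 1) :
    ∃ i, (c i = 1 ∨ c i = -1) ∧ ∀ j, c (i.succAbove j) = 0 := by
  obtain ⟨i, hi⟩ : ∃ i, c i ≠ 0 := by
    by_contra! h0
    simp [h0] at h
  rw [Fin.sum_univ_succAbove _ i] at h
  have h0 : 0 ≤ ∑ j, c (i.succAbove j) ^ 2 := Finset.sum_nonneg fun i _ => sq_nonneg _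
  have h1 : 0 < c i ^ 2 := by positivity
  refine ⟨i, sq_eq_one_iff.mp (by omega), fun j => ?_⟩
  have h2 : ∑ j, c (i.succAbove j) ^ 2 = 0 := by omega
  rw [Finset.sum_eq_zero_iff_of_nonneg fun i _ => sq_nonneg _] at h2
  simpa using h2 j

/-- The quintic increment along a norm-four vector factors into linear forms. -/
lemma exists_signs_of_quintic_eq {s : ℤ} (hs : s = 1 ∨ s = -1) {q : Fin 4 → ℂ} {p y : ℂ}
    (hp : s * p + 3 * y = 2)
    (h : 8 * ((p - s) * ∏ j, q j) + (y - 1) * (((p - s) ^ 2 + ∑ j, q j ^ 2) ^ 2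
        - 2 * ((p - s) ^ 4 + ∑ j, q j ^ 4) - 2 * (y - 1) ^ 2 * ((p - s) ^ 2 + ∑ j, q j ^ 2)
        + 3 * (y - 1) ^ 4) =
      8 * (p * ∏ j, q j) + y * ((p ^ 2 + ∑ j, q j ^ 2) ^ 2
        - 2 * (p ^ 4 + ∑ j, q j ^ 4) - 2 * y ^ 2 * (p ^ 2 + ∑ j, q j ^ 2) + 3 * y ^ 4)) :
    ∃ ε : Fin 4 → ℤ, (∀ j, ε j = 1 ∨ ε j = -1) ∧ 4 ∣ s + ∑ j, ε j + 1 ∧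
      ∑ j, q j * ε j = 0 := by
  simp only [Fin.sum_univ_four, Fin.prod_univ_four] at h ⊢
  rcases hs with rfl | rfl
  · obtain rfl : p = 2 - 3 * y := by push_cast at hp; linear_combination hp
    have key : (-q 0 + q 1 + q 2 + q 3) * (q 0 - q 1 + q 2 + q 3) * (q 0 + q 1 - q 2 + q 3) *
        (q 0 + q 1 + q 2 - q 3) = 0 := by
      push_cast at h
      linear_combination -h
    simp only [mul_eq_zero] at key
    rcases key with ((h | h) | h) | h
    · exact ⟨![-1, 1, 1, 1], by decide, by decide, by simp; linear_combination h⟩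
    · exact ⟨![1, -1, 1, 1], by decide, by decide, by simp; linear_combination h⟩
    · exact ⟨![1, 1, -1, 1], by decide, by decide, by simp; linear_combination h⟩
    · exact ⟨![1, 1, 1, -1], by decide, by decide, by simp; linear_combination h⟩
  · obtain rfl : p = 3 * y - 2 := by push_cast at hp; linear_combination -hp
    have key : (q 0 + q 1 + q 2 + q 3) * (q 0 + q 1 - q 2 - q 3) * (q 0 - q 1 + q 2 - q 3) *
        (q 0 - q 1 - q 2 + q 3) = 0 := by
      push_cast at h
      linear_combination h
    simp only [mul_eq_zero] at key
    rcases key with ((h | h) | h) | h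
    · exact ⟨![1, 1, 1, 1], by decide, by decide, by simp; linear_combination h⟩
    · exact ⟨![1, 1, -1, -1], by decide, by decide, by simp; linear_combination h⟩
    · exact ⟨![1, -1, 1, -1], by decide, by decide, by simp; linear_combination h⟩
    · exact ⟨![1, -1, -1, 1], by decide, by decide, by simp; linear_combination h⟩

lemma exists_root_of_quintic_eq {lam : Fin 6 → ℂ} {a : Fin 6 → ℤ} {i : Fin 5} {s : ℤ}
    (hs : s = 1 ∨ s = -1) (hi : a i.castSucc = 2 * s)
    (h0 : ∀ j, a (i.succAbove j).castSucc = 0) (h5 : a 5 = 2) (hB : B6 lam (halfVec a) = 2)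
    (hq : quintic (lam - halfVec a) = quintic lam) : ∃ α ∈ NE6, B6 lam α = 1 := by
  have hp : s * lam i.castSucc + 3 * (lam 5 / ((Real.sqrt 3 : ℝ) : ℂ)) = 2 := by
    rw [B6_halfVec_right, Fin.sum_univ_succAbove _ i] at hB
    simp only [hi, h0, h5] at hB
    push_cast at hB
    simp at hB
    linear_combination hB
  simp only [quintic, Pi.sub_apply, sub_div, halfVec_castSucc, halfVec_five_div,
    Fin.sum_univ_succAbove _ i, Fin.prod_univ_succAbove _ i, hi, h0, h5] at hq
  push_cast at hq
  simp only [mul_div_cancel_left₀ _ (two_ne_zero (α := ℂ)), zero_div, sub_zero,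
    div_self (two_ne_zero (α := ℂ))] at hq
  obtain ⟨ε, hε, h4, h⟩ := exists_signs_of_quintic_eq hs hp hq
  let e : Fin 6 → ℤ := Fin.snoc (α := fun _ => ℤ) (i.insertNth (α := fun _ => ℤ) s ε) 1
  have ei : e i.castSucc = s := by simp [e]
  have ej : ∀ j, e (i.succAbove j).castSucc = ε j := by simp [e]
  have e5 : e 5 = 1 := Fin.snoc_last (α := fun _ => ℤ) _ _
  refine ⟨halfVec e, ⟨halfVec_mem_PhiE6 ?_ ?_, ?_⟩, ?_⟩
  · refine Fin.lastCases (Or.inl e5) fun k => ?_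
    rcases Fin.eq_self_or_eq_succAbove i k with rfl | ⟨j, rfl⟩
    · rwa [ei]
    · rw [ej]; exact hε j
  · rw [Fin.sum_univ_castSucc, Fin.sum_univ_succAbove _ i, ei]
    simp only [ej]
    exact (show e (Fin.last 5) = 1 from e5) ▸ h4
  · rw [B6_varpiE6_halfVec, e5]
    simp
  · rw [B6_halfVec_right, Fin.sum_univ_succAbove _ i]
    simp only [ei, ej, e5, h]
    push_cast
    linear_combination hp / 2

/-- `E₆` case of the key observation: `λ - w(λ) = ϖ₆ - μ'` is solvable with `w` in the
Weyl group and `μ' ≠ ϖ₆` in the Weyl orbit of `ϖ₆` if and only if `B(λ, α) = 1` for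
some root `α` of `𝔫^std`. -/
theorem keyObservation_E6 (lam : Fin 6 → ℂ) :
    (∃ w ∈ WE6, ∃ μ' : Fin 6 → ℂ, (∃ u ∈ WE6, u varpiE6 = μ') ∧ μ' ≠ varpiE6 ∧
      lam - w lam = varpiE6 - μ') ↔
    ∃ α ∈ NE6, B6 lam α = 1 := by
  constructor
  · rintro ⟨w, hw, μ, ⟨u, hu, rfl⟩, hne, heq⟩
    have hnorm : ∀ {w}, w ∈ WE6 → ∀ x, B6 (w x) (w x) = B6 x x := fun hw x =>
      apply_eq_of_mem_WE6 (f := fun x => B6 x x) (fun α hα x => by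
        obtain ⟨-, -, -, hα2⟩ := exists_isRootLattice_of_mem_PhiE6 hα
        exact B6_sub_smul_self hα2) hw x
    obtain ⟨a, ha, hv⟩ := exists_isRootLattice_of_mem_WE6 hu
    have hself : ∀ x v : Fin 6 → ℂ, B6 (x - v) (x - v) = B6 x x - 2 * B6 x v + B6 v v := by
      intro x v
      simp only [B6, Pi.sub_apply, Fin.sum_univ_six]
      ring
    have hwl : w lam = lam - halfVec a := by rw [← hv, ← heq, sub_sub_cancel]
    have huv : u varpiE6 = varpiE6 - halfVec a := by rw [← hv, sub_sub_cancel]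
    have hl := hnorm hw lam
    have hm := hnorm hu varpiE6
    rw [hwl, hself] at hl
    rw [huv, hself, B6_varpiE6_halfVec] at hm
    have hnC : B6 (halfVec a) (halfVec a) = 2 * a 5 := by linear_combination hm
    have hlam : B6 lam (halfVec a) = a 5 := by linear_combination (hnC - hl) / 2
    have hn : ∑ i : Fin 5, a i.castSucc ^ 2 + 3 * a 5 ^ 2 = 8 * a 5 := by
      rw [B6_halfVec_halfVec, div_eq_iff (by norm_num)] at hnC
      have : (∑ i : Fin 5, a i.castSucc * a i.castSucc) + 3 * a 5 * a 5 = 2 * a 5 * 4 := by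
        exact_mod_cast hnC
      simp only [pow_two]
      linarith
    rcases eq_zero_or_one_or_two_of_norm (a := a) (by linarith) with h5 | h5 | h5
    · exfalso
      rw [h5] at hn
      have hz : ∑ i : Fin 5, a i.castSucc ^ 2 = 0 := by linarith
      rw [Finset.sum_eq_zero_iff_of_nonneg fun i _ => sq_nonneg _] at hz
      have ha0 : a = 0 := by
        ext k
        refine Fin.lastCases h5 (fun i => ?_) k
        simpa using hz i
      apply hne
      rw [huv, ha0]
      ext k
      simp [halfVec]
    · refine ⟨halfVec a, ⟨halfVec_mem_PhiE6 ?_ ha.2, ?_⟩, ?_⟩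
      · have hge : ∀ i, 1 ≤ a i ^ 2 := fun i => by
          have h1 := ha.1 i
          have h0 : a i ≠ 0 := by omega
          have : 0 < a i ^ 2 := by positivity
          omega
        have hz : ∑ i : Fin 5, (a i.castSucc ^ 2 - 1) = 0 := by
          rw [Finset.sum_sub_distrib]
          simp
          rw [h5] at hn
          linarith
        rw [Finset.sum_eq_zero_iff_of_nonneg fun i _ => by linarith [hge i.castSucc]] at hz
        refine Fin.lastCases (Or.inl h5) fun i => ?_
        exact sq_eq_one_iff.mp (by linarith [hz i (Finset.mem_univ i)])
      · rw [B6_varpiE6_halfVec, h5]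
        simp
      · rw [hlam, h5]
        simp
    · have heven : ∀ i : Fin 5, ∃ c, a i.castSucc = 2 * c := fun i => by
        have := ha.1 i.castSucc
        exact (show (2 : ℤ) ∣ a i.castSucc by omega)
      choose c hc using heven
      obtain ⟨i, hi, hj⟩ := exists_single_of_sum_sq_eq_one (c := c) (by
        simp only [hc, h5, mul_pow, ← Finset.mul_sum] at hn
        linarith)
      refine exists_root_of_quintic_eq hi (hc i) (fun j => by rw [hc, hj, mul_zero]) h5
        (by rw [hlam, h5]; norm_num) ?_
      rw [← hwl]
      exact apply_eq_of_mem_WE6 (fun α hα x => quintic_reflection hα) hw lam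
  · rintro ⟨α, ⟨hα, hϖ⟩, hl⟩
    obtain ⟨-, -, -, hα2⟩ := exists_isRootLattice_of_mem_PhiE6 hα
    let f : Module.Dual ℂ (Fin 6 → ℂ) :=
      { toFun := fun x => B6 x α
        map_add' := fun x y => by simp [B6, add_mul, Finset.sum_add_distrib]
        map_smul' := fun c x => by simp [B6, mul_assoc, Finset.mul_sum] }
    have hs : ∀ x, Module.reflection (f := f) (x := α) hα2 x = x - B6 x α • α := fun x =>
      Module.reflection_apply _ _
    have hmem : Module.reflection (f := f) (x := α) hα2 ∈ WE6 :=
      Subgroup.subset_closure ⟨α, hα, hs⟩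
    refine ⟨_, hmem, _, ⟨_, hmem, rfl⟩, ?_, ?_⟩
    · rw [hs, hϖ, one_smul]
      intro h
      rw [sub_eq_self] at h
      simp [h, B6] at hα2
    · rw [hs, hs, hl, hϖ, sub_sub_cancel, sub_sub_cancel]
end

section
/- For every λ ∈ ℂ^7 the following are equivalent: (a) there exist w ∈ W and μ' in the W-orbit of ϖ₁ with μ' ≠ ϖ₁ such that λ − w(λ) = ϖ₁ − μ'; (b) there exists α ∈ N with B(λ, α) = 1. -/
open scoped Classical

/-- The standard symmetric bilinear form on `ℂ^7`. -/
noncomputable def B7 (x y : Fin 7 → ℂ) : ℂ := ∑ i, x i * y i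

/-- The root system of type `E₇` in the coordinates of the paper:
`±e_i ± e_j` for `1 ≤ i < j ≤ 6` (zero-based: `i < j`, `(j : ℕ) < 6`), together with
`(ε₁/2, …, ε₆/2, ε·√2/2)` with `ε₁, …, ε₆, ε ∈ {1, -1}` and an even number of `+1`'s
among `ε₁, …, ε₆`, and the two vectors `±√2·e₇`. -/
noncomputable def PhiE7 : Set (Fin 7 → ℂ) :=
  {α | (∃ (i j : Fin 7) (s t : ℂ), (i : ℕ) < (j : ℕ) ∧ (j : ℕ) < 6 ∧
        (s = 1 ∨ s = -1) ∧ (t = 1 ∨ t = -1) ∧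
        α = fun k => (if k = i then s else 0) + (if k = j then t else 0)) ∨
      (∃ ε : Fin 7 → ℂ, (∀ k, ε k = 1 ∨ ε k = -1) ∧
        Even (Finset.univ.filter fun k : Fin 7 => (k : ℕ) < 6 ∧ ε k = 1).card ∧
        α = fun k : Fin 7 => if (k : ℕ) = 6 then ε k * ((Real.sqrt 2 / 2 : ℝ) : ℂ)
          else ε k / 2) ∨
      (∃ s : ℂ, (s = 1 ∨ s = -1) ∧
        α = fun k : Fin 7 => if (k : ℕ) = 6 then s * ((Real.sqrt 2 : ℝ) : ℂ) else 0)}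

/-- The minuscule fundamental weight `ϖ₁ = (1, 0, 0, 0, 0, 0, √2/2)`. -/
noncomputable def varpiE7 : Fin 7 → ℂ :=
  fun k => if (k : ℕ) = 0 then 1
    else if (k : ℕ) = 6 then ((Real.sqrt 2 / 2 : ℝ) : ℂ) else 0

/-- The Weyl group of `E₇`: the subgroup of linear automorphisms of `ℂ^7` generated by
the reflections `s_α : x ↦ x - B(x, α)·α` for `α ∈ Φ` (all roots have `B(α,α) = 2`). -/
noncomputable def WE7 : Subgroup ((Fin 7 → ℂ) ≃ₗ[ℂ] (Fin 7 → ℂ)) :=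
  Subgroup.closure
    {w : (Fin 7 → ℂ) ≃ₗ[ℂ] (Fin 7 → ℂ) | ∃ α ∈ PhiE7, ∀ x, w x = x - B7 x α • α}

/-- The Weyl group of the Levi (type `E₆`): the subgroup generated by the reflections
`s_α` for the roots `α ∈ Φ` with `B(ϖ₁, α) = 0`. -/
noncomputable def WmE7 : Subgroup ((Fin 7 → ℂ) ≃ₗ[ℂ] (Fin 7 → ℂ)) :=
  Subgroup.closure
    {w : (Fin 7 → ℂ) ≃ₗ[ℂ] (Fin 7 → ℂ) |
      ∃ α ∈ PhiE7, B7 varpiE7 α = 0 ∧ ∀ x, w x = x - B7 x α • α}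

/-- The roots of `𝔫^std`: the roots `α` with `B(ϖ₁, α) = 1`. -/
noncomputable def NE7 : Set (Fin 7 → ℂ) := {α | α ∈ PhiE7 ∧ B7 varpiE7 α = 1}

namespace E7

/-- Integer codes for vectors of `ℂ^7`: the first six coordinates are counted in units of `1/2`,
the last one in units of `√2/2`. -/
abbrev Code := (Fin 6 → ℤ) × ℤ

/-- Four times the bilinear form of the two coded vectors. -/
def ip (v w : Code) : ℤ := ∑ i, v.1 i * w.1 i + 2 * (v.2 * w.2)

/-- The codes of the roots: the vectors of norm `2` in the root lattice. -/
def IsRoot (v : Code) : Prop :=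
  ip v v = 8 ∧ (∀ i, 2 ∣ v.1 i - v.2) ∧ 4 ∣ ∑ i, v.1 i - 2 * v.2

/-- The codes of the minuscule weights: the vectors of norm `3/2` in the nontrivial coset of the
root lattice in the weight lattice. -/
def IsWeight (v : Code) : Prop :=
  ip v v = 6 ∧ (∀ i, 2 ∣ v.1 i - v.2 - 1) ∧ 4 ∣ ∑ i, v.1 i - 2 * v.2

instance (v : Code) : Decidable (IsRoot v) := inferInstanceAs (Decidable (_ ∧ _))

instance (v : Code) : Decidable (IsWeight v) := inferInstanceAs (Decidable (_ ∧ _))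

/-- The code of the weight `±e_j ± (√2/2) e₇`. -/
def vecCode (p : Fin 6 × Bool × Bool) : Code :=
  (fun i => if i = p.1 then (if p.2.1 then 2 else -2) else 0, if p.2.2 then 1 else -1)

/-- The code of the vector with coordinates `1/2` on `s`, `-1/2` off `s`, and last coordinate
`0`. -/
def spinCode (s : Finset (Fin 6)) : Code := (fun i => if i ∈ s then 1 else -1, 0)

/-- The finite set of the codes of the 56 minuscule weights. -/
def weights : Finset Code :=
  Finset.univ.image vecCode ∪ (Finset.univ.filter fun s => Odd s.card).image spinCode

/-- The code of `ϖ₁`. -/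
def varpi : Code := vecCode (0, true, true)

lemma isWeight_of_mem {v : Code} : v ∈ weights → IsWeight v := by
  revert v
  decide +kernel

lemma card_level_one : (weights.filter fun v => ip varpi v = 2).card = 27 := by
  decide +kernel

lemma ip_varpi_cases {v : Code} : v ∈ weights →
    v = varpi ∨ ip varpi v = 2 ∨ ip varpi v = -2 ∨ v = -varpi := by
  revert v
  decide +kernel

lemma exists_path {v : Code} : v ∈ weights → ip varpi v = -2 →
    v = vecCode (0, false, true) ∨ IsRoot (v - vecCode (0, false, true)) ∨
      ∃ v' ∈ weights, ip varpi v' = -2 ∧ IsRoot (v - v') ∧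
        IsRoot (v' - vecCode (0, false, true)) := by
  revert v
  decide +kernel

lemma ip_comm (v w : Code) : ip v w = ip w v := by
  simp only [ip, mul_comm]

lemma ip_sub_left (u v w : Code) : ip (u - v) w = ip u w - ip v w := by
  simp only [ip, Prod.fst_sub, Prod.snd_sub, Pi.sub_apply, sub_mul, Finset.sum_sub_distrib]
  ring

lemma ip_sub_right (u v w : Code) : ip u (v - w) = ip u v - ip u w := by
  rw [ip_comm, ip_sub_left, ip_comm v, ip_comm w]

lemma ip_smul_left (n : ℤ) (v w : Code) : ip (n • v) w = n * ip v w := by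
  simp only [ip, Prod.smul_fst, Prod.smul_snd, Pi.smul_apply, smul_eq_mul, mul_add,
    Finset.mul_sum]
  congr 1
  · exact Finset.sum_congr rfl fun i _ => by ring
  · ring

lemma ip_smul_right (n : ℤ) (v w : Code) : ip v (n • w) = n * ip v w := by
  rw [ip_comm, ip_smul_left, ip_comm]

/-- The reflection of a weight in a root, in terms of codes. -/
def refl (r v : Code) : Code := v - (ip v r / 4) • r

/-- Weights pair integrally with roots. -/
lemma IsWeight.four_dvd_ip {v r : Code} (hv : IsWeight v) (hr : IsRoot r) : 4 ∣ ip v r := by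
  obtain ⟨-, hv2, hv3⟩ := hv
  obtain ⟨-, hr2, hr3⟩ := hr
  choose c hc using hv2
  choose e he using hr2
  have hc' : ∀ i, v.1 i = v.2 + 1 + 2 * c i := fun i => by linarith [hc i]
  have he' : ∀ i, r.1 i = r.2 + 2 * e i := fun i => by linarith [he i]
  simp only [ip, hc', he', Fin.sum_univ_six] at hv3 hr3 ⊢
  obtain ⟨k, hk⟩ := hv3
  obtain ⟨m, hm⟩ := hr3
  refine ⟨c 0 * e 0 + c 1 * e 1 + c 2 * e 2 + c 3 * e 3 + c 4 * e 4 + c 5 * e 5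
    + (v.2 + 1) * (m - r.2) + r.2 * k + v.2 * r.2, ?_⟩
  linear_combination r.2 * hk + (v.2 + 1) * hm

lemma IsWeight.refl {v r : Code} (hv : IsWeight v) (hr : IsRoot r) : IsWeight (refl r v) := by
  obtain ⟨n, hn⟩ := hv.four_dvd_ip hr
  obtain ⟨hv1, hv2, hv3⟩ := hv
  obtain ⟨hr1, hr2, hr3⟩ := hr
  rw [E7.refl, hn, Int.mul_ediv_cancel_left _ four_ne_zero]
  refine ⟨?_, fun i => ?_, ?_⟩
  · simp only [ip_sub_left, ip_sub_right, ip_smul_left, ip_smul_right, ip_comm r v, hn, hv1, hr1]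
    ring
  · obtain ⟨k, hk⟩ := hv2 i
    obtain ⟨m, hm⟩ := hr2 i
    refine ⟨k - n * m, ?_⟩
    simp only [Prod.fst_sub, Prod.snd_sub, Prod.smul_fst, Prod.smul_snd, Pi.sub_apply,
      Pi.smul_apply, smul_eq_mul]
    linear_combination hk - n * hm
  · obtain ⟨k, hk⟩ := hv3
    obtain ⟨m, hm⟩ := hr3
    refine ⟨k - n * m, ?_⟩
    simp only [Prod.fst_sub, Prod.snd_sub, Prod.smul_fst, Prod.smul_snd, Pi.sub_apply,
      Pi.smul_apply, smul_eq_mul, Finset.sum_sub_distrib, ← Finset.mul_sum]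
    linear_combination hk - n * hm

lemma IsWeight.refl_refl {v r : Code} (hv : IsWeight v) (hr : IsRoot r) :
    E7.refl r (E7.refl r v) = v := by
  obtain ⟨n, hn⟩ := hv.four_dvd_ip hr
  have h : ip (E7.refl r v) r = 4 * -n := by
    rw [E7.refl, ip_sub_left, ip_smul_left, hn, Int.mul_ediv_cancel_left _ four_ne_zero, hr.1]
    ring
  rw [E7.refl, h, Int.mul_ediv_cancel_left _ four_ne_zero, E7.refl, hn,
    Int.mul_ediv_cancel_left _ four_ne_zero, neg_smul, sub_neg_eq_add, sub_add_cancel]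

lemma sum_ite_one_neg_one (s : Finset (Fin 6)) :
    ∑ i, (if i ∈ s then (1 : ℤ) else -1) = 2 * s.card - 6 := by
  revert s
  decide +kernel

/-- A vector with odd entries and squared length `6` is a vector of signs. -/
lemma exists_signs {a : Fin 6 → ℤ} (ha : ∀ i, ¬ 2 ∣ a i) (h : ∑ i, a i * a i = 6) :
    ∃ s : Finset (Fin 6), a = fun i => if i ∈ s then 1 else -1 := by
  have h1 : ∀ i, 1 ≤ a i * a i := fun i => by
    have : a i ≠ 0 := fun h0 => ha i (by simp [h0])
    have := mul_self_pos.2 this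
    omega
  have h2 : ∀ i, a i * a i = 1 := by
    have := (Finset.sum_eq_sum_iff_of_le (s := Finset.univ) (f := fun _ : Fin 6 => (1 : ℤ))
      (g := fun i => a i * a i) fun i _ => h1 i).1 (by simp [h])
    exact fun i => (this i (Finset.mem_univ i)).symm
  refine ⟨Finset.univ.filter fun i => a i = 1, funext fun i => ?_⟩
  rcases mul_self_eq_one_iff.1 (h2 i) with h | h <;> simp [h]

/-- An integer vector of squared length at most `3` is the signed indicator of its support. -/
lemma exists_support {c : Fin 6 → ℤ} {n : ℕ} (hn : n ≤ 3) (h : ∑ i, c i * c i = n) :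
    ∃ s : Finset (Fin 6), s.card = n ∧ (∀ i ∈ s, c i = 1 ∨ c i = -1) ∧ ∀ i ∉ s, c i = 0 := by
  have h1 : ∀ i, c i = 0 ∨ c i = 1 ∨ c i = -1 := fun i => by
    have h2 : c i * c i ≤ n := h ▸
      Finset.single_le_sum (f := fun i => c i * c i) (fun j _ => mul_self_nonneg (c j))
        (Finset.mem_univ i)
    have h3 : c i * c i ≤ 3 := h2.trans (by exact_mod_cast hn)
    have : c i < 2 := by nlinarith
    have : -2 < c i := by nlinarith
    omega
  refine ⟨Finset.univ.filter fun i => c i ≠ 0, ?_, fun i hi => ?_, fun i hi => ?_⟩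
  · have h2 : ∀ i, c i * c i = if c i ≠ 0 then 1 else 0 := fun i => by
      rcases h1 i with h | h | h <;> simp [h]
    simp only [h2, Finset.sum_boole] at h
    exact_mod_cast h
  · have := (Finset.mem_filter.1 hi).2
    have := h1 i
    tauto
  · simpa using hi

lemma IsWeight.mem_weights {v : Code} (hv : IsWeight v) : v ∈ weights := by
  obtain ⟨a, b⟩ := v
  obtain ⟨h1, h2, h3⟩ := hv
  simp only [ip] at h1 h2 h3
  have hnn : 0 ≤ ∑ i, a i * a i := Finset.sum_nonneg fun i _ => mul_self_nonneg (a i)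
  have hb : b = 0 ∨ b = 1 ∨ b = -1 := by
    have : b < 2 := by nlinarith
    have : -2 < b := by nlinarith
    omega
  rw [weights, Finset.mem_union, Finset.mem_image, Finset.mem_image]
  rcases hb with rfl | hb
  · right
    obtain ⟨s, rfl⟩ := exists_signs (a := a) (fun i => by have := h2 i; omega) (by linarith)
    refine ⟨s, ?_, rfl⟩
    rw [sum_ite_one_neg_one] at h3
    simp only [Finset.mem_filter, Finset.mem_univ, true_and, Nat.odd_iff]
    omega
  · left
    have h4 : ∀ i, 2 ∣ a i := fun i => by have := h2 i; omega
    choose c hc using h4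
    obtain rfl : a = fun i => 2 * c i := funext hc
    have h5 : ∑ i, c i * c i = (1 : ℕ) := by
      have : ∑ i, 2 * c i * (2 * c i) = 4 * ∑ i, c i * c i := by
        rw [Finset.mul_sum]
        exact Finset.sum_congr rfl fun i _ => by ring
      rw [this] at h1
      rcases hb with rfl | rfl <;> push_cast <;> linarith
    obtain ⟨s, hs, hs1, hs0⟩ := exists_support (by norm_num) h5
    obtain ⟨j, rfl⟩ := Finset.card_eq_one.1 hs
    refine ⟨(j, decide (c j = 1), decide (b = 1)), Finset.mem_univ _, ?_⟩
    refine Prod.ext (funext fun i => ?_) ?_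
    · by_cases hij : i = j
      · subst hij
        rcases hs1 i (by simp) with h | h <;> simp [vecCode, h]
      · simp [vecCode, hij, hs0 i (by simpa using hij)]
    · rcases hb with rfl | rfl <;> simp [vecCode]

lemma refl_mem {v r : Code} (hv : v ∈ weights) (hr : IsRoot r) : refl r v ∈ weights :=
  ((isWeight_of_mem hv).refl hr).mem_weights

lemma isRoot_sub {v w : Code} (hv : v ∈ weights) (hw : w ∈ weights) (h : ip v w = 2) :
    IsRoot (v - w) := by
  obtain ⟨hv1, hv2, hv3⟩ := isWeight_of_mem hv
  obtain ⟨hw1, hw2, hw3⟩ := isWeight_of_mem hw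
  refine ⟨?_, fun i => ?_, ?_⟩
  · simp only [ip_sub_left, ip_sub_right, ip_comm w v, h, hv1, hw1]
    norm_num
  · obtain ⟨k, hk⟩ := hv2 i
    obtain ⟨m, hm⟩ := hw2 i
    refine ⟨k - m, ?_⟩
    simp only [Prod.fst_sub, Prod.snd_sub, Pi.sub_apply]
    linear_combination hk - hm
  · obtain ⟨k, hk⟩ := hv3
    obtain ⟨m, hm⟩ := hw3
    refine ⟨k - m, ?_⟩
    simp only [Prod.fst_sub, Prod.snd_sub, Pi.sub_apply, Finset.sum_sub_distrib]
    linear_combination hk - hm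

/-- The vector of `ℂ^7` with the given code. -/
noncomputable def emb (v : Code) : Fin 7 → ℂ :=
  Fin.snoc (α := fun _ => ℂ) (fun i => (v.1 i : ℂ) / 2) (v.2 * ((Real.sqrt 2 / 2 : ℝ) : ℂ))

lemma emb_castSucc (v : Code) (i : Fin 6) : emb v i.castSucc = (v.1 i : ℂ) / 2 := by
  simp [emb]

lemma emb_last (v : Code) : emb v 6 = v.2 * ((Real.sqrt 2 / 2 : ℝ) : ℂ) :=
  Fin.snoc_last (α := fun _ => ℂ) _ _

lemma castSucc_ne_six (i : Fin 6) : i.castSucc ≠ 6 :=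
  (Fin.castSucc_lt_last i).ne

lemma funext_snoc {x y : Fin 7 → ℂ} (h : ∀ i : Fin 6, x i.castSucc = y i.castSucc)
    (h' : x 6 = y 6) : x = y :=
  funext fun k => Fin.lastCases h' h k

lemma emb_sub (v w : Code) : emb (v - w) = emb v - emb w := by
  refine funext_snoc (fun i => ?_) ?_
  · simp [emb_castSucc, sub_div]
  · simp [emb_last, sub_mul]

lemma emb_zsmul (n : ℤ) (v : Code) : emb (n • v) = (n : ℂ) • emb v := by
  refine funext_snoc (fun i => ?_) ?_
  · simp [emb_castSucc, mul_div_assoc]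
  · simp [emb_last, mul_assoc]

lemma emb_neg (v : Code) : emb (-v) = -emb v := by
  have := emb_zsmul (-1) v
  simpa using this

lemma sqrt_two_sq : ((Real.sqrt 2 : ℝ) : ℂ) * ((Real.sqrt 2 : ℝ) : ℂ) = 2 := by
  rw [← Complex.ofReal_mul, Real.mul_self_sqrt (by norm_num)]
  norm_num

lemma B7_emb (y : Fin 7 → ℂ) (v : Code) :
    B7 y (emb v) = ∑ i : Fin 6, y i.castSucc / 2 * v.1 i
      + v.2 * (y 6 * ((Real.sqrt 2 / 2 : ℝ) : ℂ)) := by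
  simp only [B7, Fin.sum_univ_castSucc (n := 6), emb_castSucc, Fin.reduceLast, emb_last]
  congr 1
  · exact Finset.sum_congr rfl fun i _ => by ring
  · ring

lemma B7_emb_emb (v w : Code) : B7 (emb v) (emb w) = (ip v w : ℂ) / 4 := by
  rw [B7_emb, ip]
  simp only [emb_castSucc, emb_last]
  push_cast
  rw [add_div, Finset.sum_div]
  congr 1
  · exact Finset.sum_congr rfl fun i _ => by ring
  · linear_combination (v.2 * w.2 / 4 : ℂ) * sqrt_two_sq

lemma B7_comm (x y : Fin 7 → ℂ) : B7 x y = B7 y x := by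
  simp only [B7, mul_comm]

lemma B7_sub_left (x y z : Fin 7 → ℂ) : B7 (x - y) z = B7 x z - B7 y z := by
  simp only [B7, Pi.sub_apply, sub_mul, Finset.sum_sub_distrib]

lemma B7_sub_right (x y z : Fin 7 → ℂ) : B7 x (y - z) = B7 x y - B7 x z := by
  rw [B7_comm, B7_sub_left, B7_comm y, B7_comm z]

lemma B7_smul_left (c : ℂ) (x y : Fin 7 → ℂ) : B7 (c • x) y = c * B7 x y := by
  simp only [B7, Pi.smul_apply, smul_eq_mul, mul_assoc, Finset.mul_sum]

lemma B7_smul_right (c : ℂ) (x y : Fin 7 → ℂ) : B7 x (c • y) = c * B7 x y := by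
  rw [B7_comm, B7_smul_left, B7_comm]

lemma varpiE7_eq : varpiE7 = emb varpi := by
  refine funext_snoc (fun i => ?_) ?_
  · fin_cases i <;> simp [varpiE7, emb, varpi, vecCode, Fin.snoc]
  · simp [varpiE7, emb_last, varpi, vecCode]

lemma isRoot_vec : ∀ (i j : Fin 6) (s t : ℤˣ), i ≠ j →
    IsRoot (fun k => (if k = i then 2 * (s : ℤ) else 0) + if k = j then 2 * (t : ℤ) else 0, 0) := by
  decide +kernel

lemma isRoot_spin : ∀ (s : Finset (Fin 6)) (t : ℤˣ), Even s.card →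
    IsRoot (fun k => if k ∈ s then 1 else -1, t) := by
  decide +kernel

lemma isRoot_last : ∀ t : ℤˣ, IsRoot (0, 2 * t) := by
  decide +kernel

lemma exists_unit {c : ℂ} (h : c = 1 ∨ c = -1) : ∃ s : ℤˣ, c = (s : ℤ) := by
  rcases h with rfl | rfl
  · exact ⟨1, by simp⟩
  · exact ⟨-1, by simp⟩

lemma exists_isRoot {α : Fin 7 → ℂ} (h : α ∈ PhiE7) : ∃ r, IsRoot r ∧ emb r = α := by
  rcases h with ⟨i, j, s, t, hij, hj, hs, ht, rfl⟩ | ⟨ε, hε, hcard, rfl⟩ | ⟨s, hs, rfl⟩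
  · obtain ⟨s, rfl⟩ := exists_unit hs
    obtain ⟨t, rfl⟩ := exists_unit ht
    obtain ⟨j, rfl⟩ : ∃ j' : Fin 6, j = j'.castSucc := ⟨⟨j, hj⟩, rfl⟩
    obtain ⟨i, rfl⟩ : ∃ i' : Fin 6, i = i'.castSucc := ⟨⟨i, hij.trans hj⟩, rfl⟩
    refine ⟨_, isRoot_vec i j s t (by rintro rfl; exact lt_irrefl _ hij), ?_⟩
    refine funext_snoc (fun k => ?_) ?_
    · simp only [emb_castSucc, Fin.castSucc_inj]
      split_ifs <;> push_cast <;> ring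
    · simp [emb_last, (castSucc_ne_six _).symm]
  · obtain ⟨t, ht⟩ := exists_unit (hε 6)
    refine ⟨_, isRoot_spin (Finset.univ.filter fun i => ε i.castSucc = 1) t ?_, ?_⟩
    · convert hcard using 1
      rw [← Finset.card_map Fin.castSuccEmb]
      congr 1
      ext k
      refine Fin.lastCases ?_ (fun i => ?_) k
      · simp [castSucc_ne_six]
      · simp
    · refine funext_snoc (fun k => ?_) ?_
      · have : (k : ℕ) ≠ 6 := k.2.ne
        rcases hε k.castSucc with h | h <;>
          norm_num [emb_castSucc, h, this]
      · simp [emb_last, ht]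
  · obtain ⟨s, rfl⟩ := exists_unit hs
    refine ⟨_, isRoot_last s, funext_snoc (fun k => ?_) ?_⟩
    · have : (k : ℕ) ≠ 6 := k.2.ne
      simp [emb_castSucc, this]
    · simp [emb_last]
      ring

lemma emb_mem_PhiE7 {r : Code} (hr : IsRoot r) : emb r ∈ PhiE7 := by
  obtain ⟨a, b⟩ := r
  obtain ⟨h1, h2, h3⟩ := hr
  simp only [ip] at h1 h2 h3
  have hnn : 0 ≤ ∑ i, a i * a i := Finset.sum_nonneg fun i _ => mul_self_nonneg (a i)
  have hb : b = 0 ∨ (b = 1 ∨ b = -1) ∨ (b = 2 ∨ b = -2) := by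
    have : b < 3 := by nlinarith
    have : -3 < b := by nlinarith
    omega
  rcases hb with rfl | hb | hb
  · left
    have h4 : ∀ i, 2 ∣ a i := fun i => by have := h2 i; omega
    choose c hc using h4
    obtain rfl : a = fun i => 2 * c i := funext hc
    have h5 : ∑ i, c i * c i = (2 : ℕ) := by
      have : ∑ i, 2 * c i * (2 * c i) = 4 * ∑ i, c i * c i := by
        rw [Finset.mul_sum]
        exact Finset.sum_congr rfl fun i _ => by ring
      rw [this] at h1
      push_cast
      linarith
    obtain ⟨s, hs, hs1, hs0⟩ := exists_support (by norm_num) h5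
    obtain ⟨i, j, hij, rfl⟩ : ∃ i j : Fin 6, i < j ∧ s = {i, j} := by
      obtain ⟨i, j, hij, rfl⟩ := Finset.card_eq_two.1 hs
      rcases lt_or_gt_of_ne hij with h | h
      · exact ⟨i, j, h, rfl⟩
      · exact ⟨j, i, h, Finset.pair_comm _ _⟩
    refine ⟨i.castSucc, j.castSucc, c i, c j, hij, j.2, ?_, ?_, funext_snoc (fun k => ?_) ?_⟩
    · exact_mod_cast hs1 i (by simp)
    · exact_mod_cast hs1 j (by simp)
    · simp only [emb_castSucc, Fin.castSucc_inj]
      rcases eq_or_ne k i with rfl | hki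
      · simp [hij.ne]
      · rcases eq_or_ne k j with rfl | hkj
        · simp [hij.ne']
        · simp [hki, hkj, hs0 k (by simp [hki, hkj])]
    · simp [emb_last, (castSucc_ne_six _).symm]
  · right; left
    obtain ⟨s, rfl⟩ := exists_signs (a := a)
      (fun i => by have := h2 i; rcases hb with rfl | rfl <;> omega)
      (by rcases hb with rfl | rfl <;> linarith)
    rw [sum_ite_one_neg_one] at h3
    refine ⟨Fin.snoc (α := fun _ => ℂ) (fun i => if i ∈ s then 1 else -1) b, fun k => ?_, ?_,
      funext_snoc (fun k => ?_) ?_⟩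
    · refine Fin.lastCases ?_ (fun i => ?_) k
      · rw [Fin.snoc_last]
        exact_mod_cast hb
      · rw [Fin.snoc_castSucc]
        exact ite_eq_or_eq _ _ _
    · have : Even s.card := by
        rw [Nat.even_iff]
        rcases hb with rfl | rfl <;> omega
      convert this using 1
      rw [← Finset.card_map (s := s) Fin.castSuccEmb]
      congr 1
      ext k
      refine Fin.lastCases ?_ (fun i => ?_) k
      · simp [castSucc_ne_six]
      · by_cases hi : i ∈ s
        · simp [hi]
        · simp [hi]
          norm_num
    · have : (k : ℕ) ≠ 6 := k.2.ne
      by_cases hk : k ∈ s <;> simp [emb_castSucc, this, hk]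
    · rw [emb_last, show (6 : Fin 7) = Fin.last 6 from rfl, Fin.snoc_last]
      exact (if_pos rfl).symm
  · right; right
    have h0 : ∑ i, a i * a i = 0 := by rcases hb with rfl | rfl <;> linarith
    have ha : a = 0 := funext fun i => mul_self_eq_zero.1
      ((Finset.sum_eq_zero_iff_of_nonneg fun i _ => mul_self_nonneg (a i)).1 h0 i
        (Finset.mem_univ i))
    subst ha
    refine ⟨(b : ℂ) / 2, ?_, funext_snoc (fun k => ?_) ?_⟩
    · rcases hb with rfl | rfl
      · left; norm_num
      · right; norm_num
    · have : (k : ℕ) ≠ 6 := k.2.ne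
      simp [emb_castSucc, this]
    · simp [emb_last]
      ring

lemma emb_refl {v r : Code} (hv : v ∈ weights) (hr : IsRoot r) :
    emb (refl r v) = emb v - B7 (emb v) (emb r) • emb r := by
  obtain ⟨n, hn⟩ := (isWeight_of_mem hv).four_dvd_ip hr
  rw [refl, emb_sub, emb_zsmul, B7_emb_emb, hn, Int.mul_ediv_cancel_left _ four_ne_zero]
  push_cast
  rw [mul_div_cancel_left₀ _ (by norm_num : (4 : ℂ) ≠ 0)]

lemma B7_self_of_mem_PhiE7 {α : Fin 7 → ℂ} (hα : α ∈ PhiE7) : B7 α α = 2 := by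
  obtain ⟨r, hr, rfl⟩ := exists_isRoot hα
  rw [B7_emb_emb, hr.1]
  norm_num

/-- The reflection in a root, as an element of the Weyl group. -/
lemma exists_reflection_mem {α : Fin 7 → ℂ} (hα : α ∈ PhiE7) :
    ∃ s ∈ WE7, ∀ x, s x = x - B7 x α • α := by
  let f : Module.Dual ℂ (Fin 7 → ℂ) :=
    { toFun := fun x => B7 x α
      map_add' := fun x y => by simp only [B7, Pi.add_apply, add_mul, Finset.sum_add_distrib]
      map_smul' := fun c x => B7_smul_left c x α }
  have h : f α = 2 := B7_self_of_mem_PhiE7 hα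
  exact ⟨Module.reflection h, Subgroup.subset_closure ⟨α, hα, fun x => Module.reflection_apply x h⟩,
    fun x => Module.reflection_apply x h⟩

lemma B7_reflection {α : Fin 7 → ℂ} (hα : α ∈ PhiE7) (x y : Fin 7 → ℂ) :
    B7 (x - B7 x α • α) (y - B7 y α • α) = B7 x y := by
  simp only [B7_sub_left, B7_sub_right, B7_smul_left, B7_smul_right, B7_comm α y,
    B7_self_of_mem_PhiE7 hα]
  ring

lemma B7_map {w : (Fin 7 → ℂ) ≃ₗ[ℂ] (Fin 7 → ℂ)} (hw : w ∈ WE7) (x y : Fin 7 → ℂ) :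
    B7 (w x) (w y) = B7 x y := by
  induction hw using Subgroup.closure_induction generalizing x y with
  | mem w hw =>
    obtain ⟨α, hα, hw⟩ := hw
    rw [hw, hw, B7_reflection hα]
  | one => rfl
  | mul u w _ _ hu hw => exact (hu _ _).trans (hw _ _)
  | inv w _ hw =>
    rw [← hw]
    exact congrArg₂ B7 (w.apply_symm_apply x) (w.apply_symm_apply y)

/-- The Weyl group permutes the minuscule weights. -/
lemma exists_map_emb {w : (Fin 7 → ℂ) ≃ₗ[ℂ] (Fin 7 → ℂ)} (hw : w ∈ WE7) {v : Code}
    (hv : v ∈ weights) :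
    (∃ v' ∈ weights, w (emb v) = emb v') ∧ ∃ v' ∈ weights, w (emb v') = emb v := by
  induction hw using Subgroup.closure_induction generalizing v with
  | mem w hw =>
    obtain ⟨α, hα, hw⟩ := hw
    obtain ⟨r, hr, rfl⟩ := exists_isRoot hα
    refine ⟨⟨refl r v, refl_mem hv hr, by rw [hw, emb_refl hv hr]⟩,
      ⟨refl r v, refl_mem hv hr, ?_⟩⟩
    rw [hw, ← emb_refl (refl_mem hv hr) hr, (isWeight_of_mem hv).refl_refl hr]
  | one => exact ⟨⟨v, hv, rfl⟩, ⟨v, hv, rfl⟩⟩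
  | mul u w _ _ hu hw =>
    constructor
    · obtain ⟨v', hv', h'⟩ := (hw hv).1
      obtain ⟨v'', hv'', h''⟩ := (hu hv').1
      exact ⟨v'', hv'', (congrArg u h').trans h''⟩
    · obtain ⟨v', hv', h'⟩ := (hu hv).2
      obtain ⟨v'', hv'', h''⟩ := (hw hv').2
      exact ⟨v'', hv'', (congrArg u h'').trans h'⟩
  | inv w _ hw =>
    constructor
    · obtain ⟨v', hv', h'⟩ := (hw hv).2
      exact ⟨v', hv', w.symm_apply_eq.2 h'.symm⟩
    · obtain ⟨v', hv', h'⟩ := (hw hv).1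
      exact ⟨v', hv', w.symm_apply_eq.2 h'.symm⟩

/-- The formal exponential `e^c` in the group ring `ℤ[ℂ]`. -/
noncomputable def fexp (c : ℂ) : AddMonoidAlgebra ℤ ℂ := AddMonoidAlgebra.single c 1

lemma fexp_add (a b : ℂ) : fexp (a + b) = fexp a * fexp b := by
  simp [fexp, AddMonoidAlgebra.single_mul_single]

lemma fexp_zero : fexp 0 = 1 := rfl

lemma fexp_sum {ι : Type*} (s : Finset ι) (f : ι → ℂ) :
    fexp (∑ i ∈ s, f i) = ∏ i ∈ s, fexp (f i) := by
  induction s using Finset.cons_induction with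
  | empty => exact fexp_zero
  | cons a s ha ih => rw [Finset.sum_cons, Finset.prod_cons, fexp_add, ih]

lemma fexp_injective : Function.Injective fexp :=
  AddMonoidAlgebra.single_left_injective one_ne_zero

/-- The formal character of the minuscule representation, evaluated along `y`. -/
noncomputable def orbitSum (y : Fin 7 → ℂ) : AddMonoidAlgebra ℤ ℂ :=
  ∑ v ∈ weights, fexp (B7 y (emb v))

lemma orbitSum_map {w : (Fin 7 → ℂ) ≃ₗ[ℂ] (Fin 7 → ℂ)} (hw : w ∈ WE7) (y : Fin 7 → ℂ) :
    orbitSum (w y) = orbitSum y := by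
  induction hw using Subgroup.closure_induction generalizing y with
  | mem w hw =>
    obtain ⟨α, hα, hw⟩ := hw
    obtain ⟨r, hr, rfl⟩ := exists_isRoot hα
    refine Finset.sum_nbij' (refl r) (refl r) (fun v hv => refl_mem hv hr)
      (fun v hv => refl_mem hv hr) (fun v hv => (isWeight_of_mem hv).refl_refl hr)
      (fun v hv => (isWeight_of_mem hv).refl_refl hr) fun v hv => ?_
    rw [hw, emb_refl hv hr, B7_sub_left, B7_sub_right, B7_smul_left, B7_smul_right,
      B7_comm (emb r), mul_comm]
  | one => rfl
  | mul u w _ _ hu hw => exact (hu _).trans (hw _)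
  | inv w _ hw =>
    rw [← hw]
    exact congrArg orbitSum (w.apply_symm_apply y)

lemma varpi_mem : varpi ∈ weights := by
  decide +kernel

/-- Some root `ϖ₁ - ω` of the nilradical, with `ω` a minuscule weight, pairs to `1` with `y`. -/
def Good (y : Fin 7 → ℂ) : Prop :=
  ∃ v ∈ weights, ip varpi v = 2 ∧ B7 y (emb (varpi - v)) = 1

lemma Good.exists_mem_NE7 {y : Fin 7 → ℂ} (h : Good y) : ∃ α ∈ NE7, B7 y α = 1 := by
  obtain ⟨v, hv, hip, hy⟩ := h
  refine ⟨_, ⟨emb_mem_PhiE7 (isRoot_sub varpi_mem hv hip), ?_⟩, hy⟩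
  rw [varpiE7_eq, B7_emb_emb, ip_sub_right, hip, (isWeight_of_mem varpi_mem).1]
  norm_num

lemma Good.of_map {u : (Fin 7 → ℂ) ≃ₗ[ℂ] (Fin 7 → ℂ)} (hu : u ∈ WE7)
    (hϖ : u (emb varpi) = emb varpi) {y : Fin 7 → ℂ} (h : Good (u y)) : Good y := by
  obtain ⟨v, hv, hip, hy⟩ := h
  obtain ⟨v', hv', h'⟩ := (exists_map_emb hu hv).2
  refine ⟨v', hv', ?_, ?_⟩
  · have := B7_map hu (emb varpi) (emb v')
    rw [hϖ, h', B7_emb_emb, B7_emb_emb, hip] at this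
    have h4 : ((2 : ℤ) : ℂ) = (ip varpi v' : ℂ) := by linear_combination 4 * this
    exact_mod_cast h4.symm
  · rw [← B7_map hu, emb_sub, map_sub, hϖ, h', ← emb_sub, hy]

lemma sum_weights {A : Type*} [AddCommMonoid A] (f : Code → A) :
    ∑ v ∈ weights, f v =
      f varpi + f (-varpi) + ∑ v ∈ weights.filter (fun v => ip varpi v = 2), (f v + f (-v)) := by
  have h1 : weights = insert varpi (weights.filter fun v => ip varpi v = 2) ∪
      (insert varpi (weights.filter fun v => ip varpi v = 2)).image fun v => -v := by
    decide +kernel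
  have h2 : Disjoint (insert varpi (weights.filter fun v => ip varpi v = 2))
      ((insert varpi (weights.filter fun v => ip varpi v = 2)).image fun v => -v) := by
    decide +kernel
  have h3 : varpi ∉ weights.filter fun v => ip varpi v = 2 := by
    decide +kernel
  conv_lhs => rw [h1]
  rw [Finset.sum_union h2, Finset.sum_image (neg_injective.injOn), Finset.sum_insert h3,
    Finset.sum_insert h3, Finset.sum_add_distrib, add_add_add_comm]

/-- The additive functional on the group ring `ℤ[ℂ]` extending a function on `ℂ`. -/
noncomputable def extend (h : ℂ → ℤ) : AddMonoidAlgebra ℤ ℂ →+ ℤ where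
  toFun x := x.coeff.sum fun c n => n * h c
  map_zero' := Finsupp.sum_zero_index
  map_add' x y := Finsupp.sum_add_index' (by simp) (by simp [add_mul])

lemma extend_fexp (h : ℂ → ℤ) (c : ℂ) : extend h (fexp c) = h c := by
  change (Finsupp.single c (1 : ℤ)).sum (fun c n => n * h c) = h c
  simp

lemma exists_eq_zero_of_sum_fexp_eq {ι : Type*} {s : Finset ι} {z : ι → ℂ} (hs : Odd s.card)
    (h : ∑ i ∈ s, fexp (z i) = ∑ i ∈ s, fexp (-z i)) : ∃ i ∈ s, z i = 0 := by
  by_contra! hz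
  let p : ℂ → ℤ := fun c => if 0 < c.re ∨ c.re = 0 ∧ 0 < c.im then 1 else 0
  have hp : ∀ c, c ≠ 0 → p c + p (-c) = 1 := fun c hc => by
    have hc' : c.re ≠ 0 ∨ c.im ≠ 0 := by
      by_contra! h
      exact hc (Complex.ext h.1 h.2)
    simp only [p, Complex.neg_re, Complex.neg_im, Left.neg_pos_iff, neg_eq_zero]
    rcases lt_trichotomy c.re 0 with h1 | h1 | h1
    · simp [h1, h1.not_gt, h1.ne]
    · rcases lt_trichotomy c.im 0 with h2 | h2 | h2
      · simp [h1, h2, h2.not_gt]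
      · simp_all
      · simp [h1, h2, h2.not_gt]
    · simp [h1, h1.not_gt, h1.ne']
  have h1 : ∑ i ∈ s, p (z i) = ∑ i ∈ s, p (-z i) := by
    simpa only [map_sum, extend_fexp] using congrArg (extend p) h
  have h2 : ∑ i ∈ s, p (z i) + ∑ i ∈ s, p (-z i) = s.card := by
    rw [← Finset.sum_add_distrib, Finset.sum_congr rfl fun i hi => hp _ (hz i hi)]
    simp
  obtain ⟨k, hk⟩ := hs
  omega

lemma good_of_sub_two_varpi {y : Fin 7 → ℂ} (h0 : B7 y (emb varpi) = 3 / 2)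
    (h : orbitSum y = orbitSum (y - (emb varpi - emb (-varpi)))) : Good y := by
  have hb : ∀ v, B7 (y - (emb varpi - emb (-varpi))) (emb v)
      = B7 y (emb v) - (ip varpi v : ℂ) / 2 := fun v => by
    rw [emb_neg, sub_neg_eq_add, ← two_smul ℂ, B7_sub_left, B7_smul_left, B7_emb_emb]
    ring
  have hneg : ∀ v, B7 y (emb (-v)) = -B7 y (emb v) := fun v => by
    rw [emb_neg, ← neg_one_smul ℂ, B7_smul_right, neg_one_mul]
  have hip : ∀ v, ip varpi (-v) = -ip varpi v := fun v => by
    rw [← neg_one_smul ℤ, ip_smul_right, neg_one_mul]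
  have h1 : (fexp (1 / 2) - fexp (-(1 / 2))) *
      (∑ v ∈ weights.filter (fun v => ip varpi v = 2), fexp (B7 y (emb v) - 1 / 2)
        - ∑ v ∈ weights.filter (fun v => ip varpi v = 2), fexp (-(B7 y (emb v) - 1 / 2)))
        = 0 := by
    rw [orbitSum, orbitSum, ← sub_eq_zero, ← Finset.sum_sub_distrib, sum_weights] at h
    rw [← h, ← Finset.sum_sub_distrib, Finset.mul_sum]
    simp only [hb, hneg, hip, h0, (isWeight_of_mem varpi_mem).1]
    refine (zero_add _).symm.trans (congrArg₂ (· + ·) ?_ (Finset.sum_congr rfl fun v hv => ?_))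
    · push_cast
      ring_nf
    · rw [(Finset.mem_filter.1 hv).2, mul_sub, sub_mul, sub_mul, ← fexp_add, ← fexp_add,
        ← fexp_add, ← fexp_add]
      push_cast
      ring_nf
  rcases mul_eq_zero.1 h1 with h2 | h2
  · have := fexp_injective (sub_eq_zero.1 h2)
    norm_num at this
  · obtain ⟨v, hv, hz⟩ := exists_eq_zero_of_sum_fexp_eq
      (by rw [card_level_one]; decide) (sub_eq_zero.1 h2)
    rw [Finset.mem_filter] at hv
    refine ⟨v, hv.1, hv.2, ?_⟩
    rw [emb_sub, B7_sub_right, h0]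
    linear_combination -hz

lemma B7_emb_vecCode (y : Fin 7 → ℂ) (j : Fin 6) (s t : Bool) :
    B7 y (emb (vecCode (j, s, t))) = (if s then y j.castSucc else -y j.castSucc)
      + (if t then 1 else -1) * (y 6 * ((Real.sqrt 2 / 2 : ℝ) : ℂ)) := by
  rw [B7_emb]
  simp only [vecCode]
  congr 1
  · rw [Finset.sum_eq_single_of_mem j (Finset.mem_univ j) fun i _ hi => by simp [hi]]
    cases s <;> simp
  · cases t <;> simp

lemma fexp_B7_spinCode (y : Fin 7 → ℂ) (s : Finset (Fin 6)) :
    fexp (B7 y (emb (spinCode s))) =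
      (∏ i ∈ s, fexp (y i.castSucc / 2)) * ∏ i ∈ sᶜ, fexp (-(y i.castSucc / 2)) := by
  rw [← fexp_sum, ← fexp_sum, ← fexp_add, B7_emb]
  congr 1
  simp only [spinCode, Int.cast_zero, zero_mul, add_zero]
  rw [← Finset.sum_add_sum_compl s]
  congr 1
  · exact Finset.sum_congr rfl fun i hi => by simp [hi]
  · exact Finset.sum_congr rfl fun i hi => by simp [Finset.mem_compl.1 hi]

lemma two_mul_sum_odd (y : Fin 7 → ℂ) :
    2 * ∑ s : Finset (Fin 6) with Odd s.card, fexp (B7 y (emb (spinCode s))) =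
      ∏ i : Fin 6, (fexp (y i.castSucc / 2) + fexp (-(y i.castSucc / 2)))
        - ∏ i : Fin 6, (-fexp (y i.castSucc / 2) + fexp (-(y i.castSucc / 2))) := by
  rw [Fintype.prod_add, Fintype.prod_add, ← Finset.sum_sub_distrib, Finset.sum_filter,
    Finset.mul_sum]
  refine Finset.sum_congr rfl fun s _ => ?_
  rw [Finset.prod_neg, fexp_B7_spinCode]
  split_ifs with hs
  · rw [hs.neg_one_pow]
    ring
  · rw [(Nat.not_odd_iff_even.1 hs).neg_one_pow]
    ring

lemma orbitSum_eq (y : Fin 7 → ℂ) :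
    orbitSum y = ∑ p, fexp (B7 y (emb (vecCode p)))
      + ∑ s : Finset (Fin 6) with Odd s.card, fexp (B7 y (emb (spinCode s))) := by
  have h1 : Function.Injective vecCode := by
    intro p q
    revert p q
    decide +kernel
  have h2 : Function.Injective spinCode := by
    intro p q
    revert p q
    decide +kernel
  have h3 : Disjoint (Finset.univ.image vecCode)
      ((Finset.univ.filter fun s : Finset (Fin 6) => Odd s.card).image spinCode) := by
    decide +kernel
  rw [orbitSum, weights, Finset.sum_union h3, Finset.sum_image h1.injOn,
    Finset.sum_image h2.injOn]

lemma B7_sub_emb_vecCode (y : Fin 7 → ℂ) (j : Fin 6) (s : Bool) :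
    B7 y (emb (varpi - vecCode (j, s, true))) =
      y 0 - if s then y j.castSucc else -y j.castSucc := by
  rw [emb_sub, B7_sub_right, varpi, B7_emb_vecCode, B7_emb_vecCode]
  simp

lemma good_of_sub_two_e {y z : Fin 7 → ℂ} (hy : y 0 = 1) (hz : z 0 = -1)
    (hyz : ∀ i, i ≠ 0 → z i = y i) (h : orbitSum y = orbitSum z) : Good y := by
  have hsucc : ∀ i : Fin 5, z i.succ.castSucc = y i.succ.castSucc := fun i =>
    hyz _ fun h => Fin.succ_ne_zero i (Fin.castSucc_injective 6 h)
  have hvec : ∑ p, fexp (B7 y (emb (vecCode p))) = ∑ p, fexp (B7 z (emb (vecCode p))) := by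
    simp only [Fintype.sum_prod_type, Fin.sum_univ_succ (n := 5), Fintype.sum_bool,
      B7_emb_vecCode, hsucc, hyz 6 (by decide), Fin.castSucc_zero, hy, hz]
    simp only [if_true, Bool.false_eq_true, if_false, neg_neg]
    abel
  have h1 := congrArg (2 * ·) (add_left_cancel
    ((orbitSum_eq y).symm.trans (h.trans ((orbitSum_eq z).trans (congrArg (· + _) hvec.symm)))))
  simp only [two_mul_sum_odd, Fin.prod_univ_succ (n := 5), hsucc, Fin.castSucc_zero, hy, hz,
    neg_div, neg_neg] at h1
  have h2 : 2 * ((fexp (1 / 2) - fexp (-(1 / 2))) * ∏ i : Fin 5,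
      (-fexp (y i.succ.castSucc / 2) + fexp (-(y i.succ.castSucc / 2)))) = 0 := by
    linear_combination h1
  have h3 : (2 : AddMonoidAlgebra ℤ ℂ) ≠ 0 := fun h => by
    have := congrArg (extend fun _ => 1) h
    rw [← one_add_one_eq_two, map_add, ← fexp_zero, extend_fexp, map_zero] at this
    norm_num at this
  rcases mul_eq_zero.1 ((mul_eq_zero.1 h2).resolve_left h3) with h4 | h4
  · have := fexp_injective (sub_eq_zero.1 h4)
    norm_num at this
  · obtain ⟨i, -, hi⟩ := Finset.prod_eq_zero_iff.1 h4
    have h5 := fexp_injective (neg_add_eq_zero.1 hi)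
    have h6 : y i.succ.castSucc = 0 := by linear_combination h5
    refine ⟨vecCode (i.succ, true, true), ?_, ?_, ?_⟩
    · exact Finset.mem_union_left _ (Finset.mem_image_of_mem _ (Finset.mem_univ _))
    · have hip : ∀ j : Fin 5, ip varpi (vecCode (j.succ, true, true)) = 2 := by decide +kernel
      exact hip i
    · rw [B7_sub_emb_vecCode, h6, hy]
      simp

/-- A minuscule weight can be moved to another one by a reflection fixing `ϖ₁` if both are at the
same level and their difference is a root. -/
lemma exists_map_of_isRoot_sub {v v' : Code} (hv : v ∈ weights) (hv' : v' ∈ weights)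
    (h : ip varpi v = ip varpi v') (hr : IsRoot (v - v')) :
    ∃ u ∈ WE7, u (emb varpi) = emb varpi ∧ u (emb v) = emb v' := by
  obtain ⟨u, hu, hu'⟩ := exists_reflection_mem (emb_mem_PhiE7 hr)
  refine ⟨u, hu, ?_, ?_⟩
  · rw [hu', B7_emb_emb, ip_sub_right, h]
    simp
  · have h8 := hr.1
    rw [ip_sub_left, ip_sub_right, ip_sub_right, ip_comm v' v, (isWeight_of_mem hv).1,
      (isWeight_of_mem hv').1] at h8
    have h4 : ip v (v - v') = 4 := by
      rw [ip_sub_right, (isWeight_of_mem hv).1]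
      linarith
    rw [hu', B7_emb_emb, h4, emb_sub]
    norm_num

lemma exists_map_eq {v : Code} (hv : v ∈ weights) (h : ip varpi v = -2) :
    ∃ u ∈ WE7, u (emb varpi) = emb varpi ∧ u (emb v) = emb (vecCode (0, false, true)) := by
  have h0 : vecCode (0, false, true) ∈ weights ∧ ip varpi (vecCode (0, false, true)) = -2 := by
    decide +kernel
  rcases exists_path hv h with rfl | hr | ⟨v', hv', hip, hr, hr'⟩
  · exact ⟨1, one_mem _, rfl, rfl⟩
  · exact exists_map_of_isRoot_sub hv h0.1 (h.trans h0.2.symm) hr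
  · obtain ⟨u, hu, hu1, hu2⟩ := exists_map_of_isRoot_sub hv hv' (h.trans hip.symm) hr
    obtain ⟨u', hu', hu1', hu2'⟩ := exists_map_of_isRoot_sub hv' h0.1 (hip.trans h0.2.symm) hr'
    exact ⟨u' * u, mul_mem hu' hu, (congrArg u' hu1).trans hu1', (congrArg u' hu2).trans hu2'⟩

lemma good_of_orbitSum_eq {y : Fin 7 → ℂ} {v : Code} (hv : v ∈ weights) (hne : v ≠ varpi)
    (hnorm : 2 * B7 y (emb varpi - emb v) = B7 (emb varpi - emb v) (emb varpi - emb v))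
    (h : orbitSum y = orbitSum (y - (emb varpi - emb v))) : Good y := by
  have hself : B7 (emb varpi - emb v) (emb varpi - emb v) = 3 - (ip varpi v : ℂ) / 2 := by
    rw [← emb_sub, B7_emb_emb, ip_sub_left, ip_sub_right, ip_sub_right, ip_comm v varpi,
      (isWeight_of_mem hv).1, (isWeight_of_mem varpi_mem).1]
    push_cast
    ring
  rw [hself] at hnorm
  rcases ip_varpi_cases hv with hv' | hip | hip | rfl
  · exact absurd hv' hne
  · refine ⟨v, hv, hip, ?_⟩
    rw [hip, ← emb_sub] at hnorm
    push_cast at hnorm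
    linear_combination hnorm / 2
  · obtain ⟨u, hu, hu1, hu2⟩ := exists_map_eq hv hip
    refine Good.of_map hu hu1 ?_
    rw [← B7_map hu, map_sub, hu1, hu2, ← emb_sub, B7_sub_emb_vecCode, hip]
      at hnorm
    rw [← orbitSum_map hu, ← orbitSum_map hu (y - _), map_sub, map_sub, hu1, hu2] at h
    have h0 : u y 0 = 1 := by
      have h00 : (Fin.castSucc (0 : Fin 6)) = 0 := rfl
      rw [h00] at hnorm
      push_cast at hnorm
      linear_combination hnorm / 4
    refine good_of_sub_two_e h0 ?_ (fun i hi => ?_) h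
    · rw [Pi.sub_apply, h0, ← emb_sub, ← Fin.castSucc_zero, emb_castSucc]
      norm_num [varpi, vecCode]
    · rw [Pi.sub_apply, ← emb_sub, sub_eq_self]
      induction i using Fin.lastCases with
      | last => exact (emb_last _).trans (by simp [varpi, vecCode])
      | cast i =>
        have : i ≠ 0 := by
          rintro rfl
          exact hi rfl
        rw [emb_castSucc]
        simp [varpi, vecCode, this]
  · refine good_of_sub_two_varpi ?_ h
    have hip : ip varpi (-varpi) = -6 := by decide
    rw [hip, emb_neg, sub_neg_eq_add, ← two_smul ℂ, B7_smul_right] at hnorm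
    push_cast at hnorm
    linear_combination hnorm / 4

end E7

/-- `E₇` case of the key observation: `λ - w(λ) = ϖ₁ - μ'` is solvable with `w` in the
Weyl group and `μ' ≠ ϖ₁` in the Weyl orbit of `ϖ₁` if and only if `B(λ, α) = 1` for
some root `α` of `𝔫^std`. -/
theorem keyObservation_E7 (lam : Fin 7 → ℂ) :
    (∃ w ∈ WE7, ∃ μ' : Fin 7 → ℂ, (∃ u ∈ WE7, u varpiE7 = μ') ∧ μ' ≠ varpiE7 ∧
      lam - w lam = varpiE7 - μ') ↔
    ∃ α ∈ NE7, B7 lam α = 1 := by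
  constructor
  · rintro ⟨w, hw, _, ⟨u, hu, rfl⟩, hne, h⟩
    rw [E7.varpiE7_eq] at hne h
    obtain ⟨v, hv, huv⟩ := (E7.exists_map_emb hu E7.varpi_mem).1
    rw [huv] at hne h
    have hwlam : w lam = lam - (E7.emb E7.varpi - E7.emb v) := by rw [← h, sub_sub_cancel]
    refine (E7.good_of_orbitSum_eq hv (fun h' => hne (congrArg _ h')) ?_ ?_).exists_mem_NE7
    · have := E7.B7_map hw lam lam
      rw [hwlam, E7.B7_sub_left, E7.B7_sub_right lam, E7.B7_sub_right _ lam,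
        E7.B7_comm (_ - _) lam] at this
      linear_combination -this
    · rw [← hwlam, E7.orbitSum_map hw]
  · rintro ⟨α, ⟨hα, hϖ⟩, hlam⟩
    obtain ⟨s, hs, hs'⟩ := E7.exists_reflection_mem hα
    refine ⟨s, hs, _, ⟨s, hs, rfl⟩, fun h => ?_, ?_⟩
    · rw [hs', hϖ, one_smul, sub_eq_self] at h
      simp [h, B7] at hϖ
    · rw [hs', hs', hϖ, hlam, sub_sub_cancel, sub_sub_cancel]
end

section
/- Let W_m be the subgroup of GL(ℂ^7) generated by {s_α : α ∈ Φ and B(ϖ₁, α) = 0} (a Weyl group of type E₆). Then W_m acts transitively on N: for all α, β ∈ N there exists w ∈ W_m with w(α) = β. -/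
open scoped Classical

/-- The half-spin vector whose sign at `k` is `+1` exactly when `k ∈ S`. -/
noncomputable def spinE7 (S : Finset (Fin 7)) : Fin 7 → ℂ := fun k =>
  if (k : ℕ) = 6 then (if k ∈ S then 1 else -1) * ((Real.sqrt 2 / 2 : ℝ) : ℂ)
  else (if k ∈ S then 1 else -1) / 2

/-- The root `√2·e₇`. -/
noncomputable def longE7 : Fin 7 → ℂ :=
  fun k => if (k : ℕ) = 6 then ((Real.sqrt 2 : ℝ) : ℂ) else 0

/-- The vector `e₁ + t·e_j` (with `j` zero-based). -/
noncomputable def vecE7 (j : Fin 7) (t : ℂ) : Fin 7 → ℂ :=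
  fun k => (if k = 0 then 1 else 0) + (if k = j then t else 0)

lemma sqrt_two_mul_self_complex : ((Real.sqrt 2 : ℝ) : ℂ) * ((Real.sqrt 2 : ℝ) : ℂ) = 2 := by
  rw [← Complex.ofReal_mul, Real.mul_self_sqrt (by norm_num)]
  norm_num

lemma B7_sub_left (x y z : Fin 7 → ℂ) : B7 (x - y) z = B7 x z - B7 y z := by
  simp [B7, sub_mul, Finset.sum_sub_distrib]

lemma B7_comm (x y : Fin 7 → ℂ) : B7 x y = B7 y x := by
  simp [B7, mul_comm]

lemma B7_sub_right (x y z : Fin 7 → ℂ) : B7 x (y - z) = B7 x y - B7 x z := by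
  rw [B7_comm, B7_sub_left, B7_comm y, B7_comm z]

lemma B7_varpiE7 (x : Fin 7 → ℂ) :
    B7 varpiE7 x = x 0 + ((Real.sqrt 2 : ℝ) : ℂ) / 2 * x 6 := by
  simp [B7, varpiE7, Fin.sum_univ_seven]

/-- The linear form `B(·, δ)`. -/
noncomputable def formE7 (δ : Fin 7 → ℂ) : Module.Dual ℂ (Fin 7 → ℂ) where
  toFun x := B7 x δ
  map_add' x y := by simp [B7, add_mul, Finset.sum_add_distrib]
  map_smul' c x := by simp [B7, mul_assoc, Finset.mul_sum]

/-- If `α, β` have square length `2`, pairing `1`, equal pairing with `ϖ₁`, and `α - β` is a root,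
then the reflection in `α - β` lies in `W_m` and maps `α` to `β`. -/
lemma exists_mem_WmE7_apply_eq {α β : Fin 7 → ℂ} (hα : B7 α α = 2) (hβ : B7 β β = 2)
    (hαβ : B7 α β = 1) (hϖ : B7 varpiE7 α = B7 varpiE7 β) (hΦ : α - β ∈ PhiE7) :
    ∃ w ∈ WmE7, w α = β := by
  have h2 : formE7 (α - β) (α - β) = 2 := by
    change B7 _ _ = 2
    rw [B7_sub_left, B7_sub_right, B7_sub_right, B7_comm β α, hα, hβ, hαβ]
    norm_num
  refine ⟨Module.reflection h2, Subgroup.subset_closure ⟨α - β, hΦ, ?_, fun x => ?_⟩, ?_⟩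
  · rw [B7_sub_right, hϖ, sub_self]
  · rw [Module.reflection_apply]
    rfl
  · rw [Module.reflection_apply]
    change α - B7 α (α - β) • (α - β) = β
    rw [B7_sub_right, hα, hαβ]
    norm_num

lemma spinE7_mem_PhiE7 {S : Finset (Fin 7)} (hS : Even (S.erase 6).card) :
    spinE7 S ∈ PhiE7 := by
  refine Or.inr (Or.inl ⟨fun k => if k ∈ S then 1 else -1, fun k => ?_, ?_, rfl⟩)
  · by_cases h : k ∈ S <;> simp [h]
  · convert hS using 2
    ext k
    have h1 : (-1 : ℂ) ≠ 1 := by norm_num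
    by_cases h : k ∈ S
    · simp [h, Fin.ext_iff]
      omega
    · simp [h, h1]

lemma B7_longE7_self : B7 longE7 longE7 = 2 := by
  simp [B7, longE7, Fin.sum_univ_seven, sqrt_two_mul_self_complex]

lemma B7_spinE7_self (S : Finset (Fin 7)) : B7 (spinE7 S) (spinE7 S) = 2 := by
  have h : ∀ k : Fin 7, (if k ∈ S then (1 : ℂ) else -1) * (if k ∈ S then 1 else -1) = 1 := by
    intro k
    by_cases h : k ∈ S <;> simp [h]
  have h6 : ∀ k : Fin 7, (k : ℕ) = 6 ↔ k = 6 := by decide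
  simp only [B7, spinE7, Fin.sum_univ_seven, h6, Fin.reduceEq, if_true, if_false,
    Complex.ofReal_div, Complex.ofReal_ofNat]
  linear_combination (h 0 + h 1 + h 2 + h 3 + h 4 + h 5) / 4 + h 6 / 2
    + (if (6 : Fin 7) ∈ S then (1 : ℂ) else -1) * (if 6 ∈ S then 1 else -1) / 4
      * sqrt_two_mul_self_complex

lemma B7_vecE7_self {j : Fin 7} {t : ℂ} (hj : j ≠ 0) (ht : t * t = 1) :
    B7 (vecE7 j t) (vecE7 j t) = 2 := by
  have h : ∀ k, vecE7 j t k * vecE7 j t k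
      = (if k = 0 then 1 else 0) + (if k = j then 1 else 0) := by
    intro k
    by_cases h0 : k = 0
    · simp [vecE7, h0, hj.symm]
    · by_cases h1 : k = j <;> simp [vecE7, h0, h1, hj, ht]
  simp only [B7, h, Finset.sum_add_distrib, Finset.sum_ite_eq', Finset.mem_univ, if_true]
  norm_num

lemma B7_vecE7_right (x : Fin 7 → ℂ) (j : Fin 7) (t : ℂ) : B7 x (vecE7 j t) = x 0 + x j * t := by
  simp [B7, vecE7, mul_add, Finset.sum_add_distrib]

lemma B7_varpiE7_spinE7 {S : Finset (Fin 7)} (h0 : 0 ∈ S) (h6 : 6 ∈ S) :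
    B7 varpiE7 (spinE7 S) = 1 := by
  rw [B7_varpiE7]
  simp [spinE7, h0, h6]
  linear_combination sqrt_two_mul_self_complex / 4

lemma B7_varpiE7_longE7 : B7 varpiE7 longE7 = 1 := by
  rw [B7_varpiE7]
  simp [longE7]
  linear_combination sqrt_two_mul_self_complex / 2

lemma exists_mem_WmE7_spinE7_eq_longE7 {S : Finset (Fin 7)} (h0 : 0 ∈ S) (h6 : 6 ∈ S)
    (hS : Even (S.erase 6).card) : ∃ w ∈ WmE7, w (spinE7 S) = longE7 := by
  refine exists_mem_WmE7_apply_eq (B7_spinE7_self S) B7_longE7_self ?_ ?_ ?_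
  · simp [B7, spinE7, longE7, Fin.sum_univ_seven, h6]
    linear_combination sqrt_two_mul_self_complex / 2
  · rw [B7_varpiE7_spinE7 h0 h6, B7_varpiE7_longE7]
  · have : spinE7 S - longE7 = spinE7 (S.erase 6) := by
      ext k
      by_cases hk : k = 6
      · simp [spinE7, longE7, hk, h6]
        ring
      · have hk' : (k : ℕ) ≠ 6 := fun h => hk (Fin.ext h)
        simp [spinE7, longE7, hk, hk']
    rw [this]
    exact spinE7_mem_PhiE7 (by simpa using hS)

/-- If the half-spin roots of `S` and `T` differ by `e₁ + t·e_j` and `0, 6 ∈ S`, then `e₁ + t·e_j`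
is conjugate to `√2·e₇` under `W_m`. -/
lemma exists_mem_WmE7_vecE7_eq_longE7_of_spinE7 {S T : Finset (Fin 7)} {j : Fin 7} {t : ℂ}
    (h0 : 0 ∈ S) (h6 : 6 ∈ S) (hS : Even (S.erase 6).card) (hT : Even (T.erase 6).card)
    (hj : j ≠ 0) (hj6 : j ≠ 6) (ht : t * t = 1) (hjS : (if j ∈ S then (1 : ℂ) else -1) = t)
    (hjT : (if j ∈ T then (1 : ℂ) else -1) = -t) (h0T : 0 ∉ T)
    (hST : ∀ k, k ≠ 0 → k ≠ j → (k ∈ S ↔ k ∈ T)) :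
    ∃ w ∈ WmE7, w (vecE7 j t) = longE7 := by
  have hj6' : (j : ℕ) ≠ 6 := fun h => hj6 (Fin.ext h)
  have hpair : B7 (spinE7 S) (vecE7 j t) = 1 := by
    rw [B7_vecE7_right]
    simp only [spinE7, hj6', hjS, h0]
    norm_num
    linear_combination ht / 2
  have hdiff : spinE7 S - vecE7 j t = spinE7 T := by
    ext k
    by_cases hk0 : k = 0
    · simp [spinE7, vecE7, hk0, h0, h0T, hj.symm]
      norm_num
    · by_cases hkj : k = j
      · subst hkj
        simp only [Pi.sub_apply, spinE7, vecE7, hj6', hjS, hjT, hk0, if_true, if_false]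
        ring
      · simp [spinE7, vecE7, hk0, hkj, hST k hk0 hkj]
  obtain ⟨u, hu, hu'⟩ := exists_mem_WmE7_spinE7_eq_longE7 h0 h6 hS
  obtain ⟨v, hv, hv'⟩ := exists_mem_WmE7_apply_eq (B7_spinE7_self S) (B7_vecE7_self hj ht) hpair
    (by
      rw [B7_varpiE7_spinE7 h0 h6, B7_vecE7_right]
      simp [varpiE7, hj6', Fin.val_ne_zero_iff.mpr hj])
    (hdiff ▸ spinE7_mem_PhiE7 hT)
  refine ⟨u * v⁻¹, mul_mem hu (inv_mem hv), ?_⟩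
  rw [← hv', LinearEquiv.mul_apply, ← LinearEquiv.mul_apply v⁻¹, inv_mul_cancel]
  exact hu'

lemma exists_mem_WmE7_vecE7_eq_longE7 {j : Fin 7} {t : ℂ} (hj : j ≠ 0) (hj6 : j ≠ 6)
    (ht : t = 1 ∨ t = -1) : ∃ w ∈ WmE7, w (vecE7 j t) = longE7 := by
  rcases ht with rfl | rfl
  · refine exists_mem_WmE7_vecE7_eq_longE7_of_spinE7 (S := {0, j, 6}) (T := {6})
      (by simp) (by simp) ?_ (by simp) hj hj6 (by simp) (by simp) (by simp [hj6]) (by simp) ?_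
    · revert j; decide
    · revert j; decide
  · obtain ⟨i, hi0, hi6, hij⟩ : ∃ i : Fin 7, i ≠ 0 ∧ i ≠ 6 ∧ i ≠ j := by
      revert j; decide
    refine exists_mem_WmE7_vecE7_eq_longE7_of_spinE7 (S := {0, i, 6}) (T := {i, j, 6})
      (by simp) (by simp) ?_ ?_ hj hj6 (by simp) (by simp [hj, hj6, hij.symm]) (by simp)
      (by simp [hi0.symm, hj.symm]) ?_
    · revert i j; decide
    · revert i j; decide
    · intro k hk0 hkj
      simp [hk0, hkj]

lemma exists_mem_WmE7_eq_longE7 {α : Fin 7 → ℂ} (hα : α ∈ NE7) :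
    ∃ w ∈ WmE7, w α = longE7 := by
  obtain ⟨hΦ, h1⟩ := hα
  rw [B7_varpiE7] at h1
  rcases hΦ with ⟨i, j, s, t, hij, hj, hs, ht, rfl⟩ | ⟨ε, hε, hev, rfl⟩ | ⟨s, hs, rfl⟩
  · have hj0 : j ≠ 0 := by rintro rfl; simp at hij
    have hj6 : j ≠ 6 := by rintro rfl; simp at hj
    have hi6 : i ≠ 6 := by rintro rfl; simp at hij; omega
    simp only [hj0.symm, hj6.symm, hi6.symm, if_false, add_zero, mul_zero] at h1
    by_cases hi : (0 : Fin 7) = i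
    · rw [if_pos hi] at h1
      subst hi h1
      exact exists_mem_WmE7_vecE7_eq_longE7 hj0 hj6 ht
    · simp [hi] at h1
  · have hsum : ε 0 + ε 6 = 2 := by
      simp at h1
      linear_combination 2 * h1 - ε 6 / 2 * sqrt_two_mul_self_complex
    have h06 : ε 0 = 1 ∧ ε 6 = 1 := by
      rcases hε 0 with h | h <;> rcases hε 6 with h' | h' <;> rw [h, h'] at hsum <;>
        first
        | exact ⟨h, h'⟩
        | norm_num at hsum
    have hs : (fun k : Fin 7 => if (k : ℕ) = 6 then ε k * ((Real.sqrt 2 / 2 : ℝ) : ℂ)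
        else ε k / 2) = spinE7 (Finset.univ.filter fun k => ε k = 1) := by
      have hk : ∀ k, (if ε k = 1 then (1 : ℂ) else -1) = ε k := by
        intro k
        rcases hε k with h | h <;> rw [h] <;> norm_num
      ext k
      simp [spinE7, hk]
    rw [hs]
    refine exists_mem_WmE7_spinE7_eq_longE7 (by simp [h06]) (by simp [h06]) ?_
    convert hev using 2
    ext k
    simp [Fin.ext_iff]
    omega
  · have : s = 1 := by
      simp at h1
      linear_combination h1 - s / 2 * sqrt_two_mul_self_complex
    subst this
    exact ⟨1, one_mem _, by ext k; simp [longE7]⟩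

/-- The Levi Weyl group `W_m` (of type `E₆`) acts transitively on the set `N` of roots of
`𝔫^std` in type `E₇`. -/
theorem Wm_transitive_on_N_E7 :
    ∀ α ∈ NE7, ∀ β ∈ NE7, ∃ w ∈ WmE7, w α = β := by
  intro α hα β hβ
  obtain ⟨u, hu, hu'⟩ := exists_mem_WmE7_eq_longE7 hα
  obtain ⟨v, hv, hv'⟩ := exists_mem_WmE7_eq_longE7 hβ
  refine ⟨v⁻¹ * u, mul_mem (inv_mem hv) hu, ?_⟩
  rw [LinearEquiv.mul_apply, hu', ← hv', ← LinearEquiv.mul_apply, inv_mul_cancel]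
  rfl
end

section
/- Let W_m be the subgroup of GL(ℂ^7) generated by {s_α : α ∈ Φ and B(ϖ₁, α) = 0} (a Weyl group of type E₆). Then the W_m-orbit of ϖ₇ := (0, 0, 0, 0, 0, 0, √2) in ℂ^7 has exactly 27 elements. -/
open scoped Classical

/-- The weight `ϖ₇ = (0, 0, 0, 0, 0, 0, √2)`. -/
noncomputable def varpiE7seven : Fin 7 → ℂ :=
  fun k => if (k : ℕ) = 6 then ((Real.sqrt 2 : ℝ) : ℂ) else 0

/-- The real scale factor of the `k`-th coordinate of the root lattice. -/
noncomputable def latticeScale (k : Fin 7) : ℂ :=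
  if (k : ℕ) = 6 then ((Real.sqrt 2 / 2 : ℝ) : ℂ) else 1 / 2

/-- The vector of `ℂ^7` with integral coordinates `a` with respect to
`e₁/2, …, e₆/2, (√2/2)·e₇`. -/
noncomputable def ofLattice (a : Fin 7 → ℤ) : Fin 7 → ℂ := fun k => a k * latticeScale k

/-- Four times the bilinear form, in integral coordinates. -/
def latticeForm (a b : Fin 7 → ℤ) : ℤ :=
  a 0 * b 0 + a 1 * b 1 + a 2 * b 2 + a 3 * b 3 + a 4 * b 4 + a 5 * b 5 + 2 * (a 6 * b 6)

/-- Membership in the root lattice of type `E₇`, in integral coordinates. -/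
def IsInRootLattice (a : Fin 7 → ℤ) : Prop :=
  (∀ k, a k % 2 = a 6 % 2) ∧ (a 0 + a 1 + a 2 + a 3 + a 4 + a 5) % 4 = (2 * a 6) % 4

/-- The roots having inner product `1` with `ϖ₁`, in integral coordinates. -/
def nilradicalRoots : Set (Fin 7 → ℤ) :=
  {a | IsInRootLattice a ∧ latticeForm a a = 8 ∧ a 0 + a 6 = 2}

lemma sqrt_two_div_two_sq : ((Real.sqrt 2 / 2 : ℝ) : ℂ) ^ 2 = 1 / 2 := by
  rw [← Complex.ofReal_pow, div_pow, Real.sq_sqrt (by norm_num)]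
  norm_num

lemma latticeScale_ne_zero (k : Fin 7) : latticeScale k ≠ 0 := by
  unfold latticeScale
  split_ifs
  · intro h
    have := sqrt_two_div_two_sq
    rw [h] at this
    norm_num at this
  · norm_num

lemma ofLattice_injective : Function.Injective ofLattice := by
  intro a b h
  funext k
  have hk := congrFun h k
  simpa [ofLattice, latticeScale_ne_zero] using hk

lemma B7_ofLattice (a b : Fin 7 → ℤ) :
    B7 (ofLattice a) (ofLattice b) = (latticeForm a b : ℂ) / 4 := by
  simp only [B7, ofLattice, latticeScale, latticeForm, Fin.sum_univ_seven]
  norm_num [-Complex.ofReal_div]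
  linear_combination (a 6 * b 6 : ℂ) * sqrt_two_div_two_sq

lemma B7_sub_smul (x y z : Fin 7 → ℂ) (c : ℂ) : B7 (x - c • y) z = B7 x z - c * B7 y z := by
  simp only [B7, Fin.sum_univ_seven, Pi.sub_apply, Pi.smul_apply, smul_eq_mul]
  ring

lemma ofLattice_sub_smul (a b : Fin 7 → ℤ) (c : ℤ) :
    ofLattice (a - c • b) = ofLattice a - (c : ℂ) • ofLattice b := by
  funext k
  simp [ofLattice]
  ring

lemma varpiE7_eq_ofLattice : varpiE7 = ofLattice ![2, 0, 0, 0, 0, 0, 1] := by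
  funext k
  fin_cases k <;> simp [varpiE7, ofLattice, latticeScale]

lemma varpiE7seven_eq_ofLattice : varpiE7seven = ofLattice ![0, 0, 0, 0, 0, 0, 2] := by
  funext k
  fin_cases k <;> simp [varpiE7seven, ofLattice, latticeScale]
  ring

lemma four_dvd_latticeForm {a b : Fin 7 → ℤ} (ha : IsInRootLattice a) (hb : IsInRootLattice b) :
    (4 : ℤ) ∣ latticeForm a b := by
  obtain ⟨ha, ha'⟩ := ha
  obtain ⟨hb, hb'⟩ := hb
  have hu : ∀ k, ∃ u, a k = a 6 + 2 * u := fun k => ⟨(a k - a 6) / 2, by have := ha k; omega⟩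
  have hv : ∀ k, ∃ v, b k = b 6 + 2 * v := fun k => ⟨(b k - b 6) / 2, by have := hb k; omega⟩
  choose u hu using hu
  choose v hv using hv
  obtain ⟨m, hm⟩ : ∃ m, u 0 + u 1 + u 2 + u 3 + u 4 + u 5 = 2 * m := by
    refine ⟨(u 0 + u 1 + u 2 + u 3 + u 4 + u 5) / 2, ?_⟩
    have := hu 0; have := hu 1; have := hu 2; have := hu 3; have := hu 4; have := hu 5
    omega
  obtain ⟨n, hn⟩ : ∃ n, v 0 + v 1 + v 2 + v 3 + v 4 + v 5 = 2 * n := by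
    refine ⟨(v 0 + v 1 + v 2 + v 3 + v 4 + v 5) / 2, ?_⟩
    have := hv 0; have := hv 1; have := hv 2; have := hv 3; have := hv 4; have := hv 5
    omega
  refine ⟨2 * (a 6 * b 6) + a 6 * n + b 6 * m + (u 0 * v 0 + u 1 * v 1 + u 2 * v 2 + u 3 * v 3 +
    u 4 * v 4 + u 5 * v 5), ?_⟩
  rw [latticeForm, hu 0, hu 1, hu 2, hu 3, hu 4, hu 5, hv 0, hv 1, hv 2, hv 3, hv 4, hv 5]
  linear_combination 2 * a 6 * hn + 2 * b 6 * hm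

lemma IsInRootLattice.sub_smul {a b : Fin 7 → ℤ} (ha : IsInRootLattice a)
    (hb : IsInRootLattice b) (c : ℤ) : IsInRootLattice (a - c • b) := by
  refine ⟨fun k => Int.ModEq.sub (ha.1 k) (Int.ModEq.mul_left c (hb.1 k)), ?_⟩
  have h := Int.ModEq.sub ha.2 (Int.ModEq.mul_left c hb.2)
  unfold Int.ModEq at h
  simp only [Pi.sub_apply, Pi.smul_apply, smul_eq_mul]
  convert h using 2 <;> ring

lemma sub_smul_mem_nilradicalRoots {a b : Fin 7 → ℤ} {c : ℤ} (ha : a ∈ nilradicalRoots)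
    (hb : IsInRootLattice b) (hb8 : latticeForm b b = 8) (hb0 : b 0 + b 6 = 0)
    (hc : latticeForm a b = 4 * c) : a - c • b ∈ nilradicalRoots := by
  obtain ⟨h1, h2, h3⟩ := ha
  refine ⟨h1.sub_smul hb c, ?_, ?_⟩
  · simp only [latticeForm, Pi.sub_apply, Pi.smul_apply, smul_eq_mul] at *
    linear_combination h2 - 2 * c * hc + c ^ 2 * hb8
  · simp only [Pi.sub_apply, Pi.smul_apply, smul_eq_mul]
    linear_combination h3 - c * hb0

lemma two_mul_card_filter_eq_one {a : Fin 7 → ℤ} {ε : Fin 7 → ℂ} (hε : ∀ k, ε k = a k)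
    (ha : ∀ k, a k = 1 ∨ a k = -1) :
    2 * ((Finset.univ.filter fun k : Fin 7 => (k : ℕ) < 6 ∧ ε k = 1).card : ℤ) =
      a 0 + a 1 + a 2 + a 3 + a 4 + a 5 + 6 := by
  have hk : ∀ k, 2 * (if a k = 1 then (1 : ℤ) else 0) = a k + 1 := by
    intro k
    rcases ha k with h | h <;> simp [h]
  have hcast : ∀ k, ((a k : ℂ) = 1) = (a k = 1) := fun k => by norm_cast
  simp only [Finset.card_filter, hε, hcast, Fin.sum_univ_seven]
  push_cast
  simp
  linear_combination hk 0 + hk 1 + hk 2 + hk 3 + hk 4 + hk 5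

lemma even_card_filter_eq_one_iff {a : Fin 7 → ℤ} {ε : Fin 7 → ℂ} (hε : ∀ k, ε k = a k)
    (ha : ∀ k, a k = 1 ∨ a k = -1) :
    Even (Finset.univ.filter fun k : Fin 7 => (k : ℕ) < 6 ∧ ε k = 1).card ↔
      (a 0 + a 1 + a 2 + a 3 + a 4 + a 5) % 4 = 2 := by
  have h := two_mul_card_filter_eq_one hε ha
  rw [Nat.even_iff]
  omega

lemma ofLattice_mem_PhiE7 {a : Fin 7 → ℤ} (ha : ∀ k, a k = 1 ∨ a k = -1)
    (h : (a 0 + a 1 + a 2 + a 3 + a 4 + a 5) % 4 = 2) : ofLattice a ∈ PhiE7 := by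
  refine Or.inr (Or.inl ⟨fun k => a k, fun k => ?_,
    (even_card_filter_eq_one_iff (fun _ => rfl) ha).2 h, ?_⟩)
  · rcases ha k with h | h <;> simp [h]
  · funext k
    simp only [ofLattice, latticeScale]
    split_ifs <;> ring

lemma exists_int_sign {s : ℂ} (hs : s = 1 ∨ s = -1) : ∃ z : ℤ, s = z ∧ (z = 1 ∨ z = -1) := by
  rcases hs with h | h
  · exact ⟨1, by simp [h]⟩
  · exact ⟨-1, by simp [h]⟩

lemma exists_lattice_of_mem_PhiE7 {α : Fin 7 → ℂ} (hα : α ∈ PhiE7) :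
    ∃ a, α = ofLattice a ∧ IsInRootLattice a ∧ latticeForm a a = 8 := by
  rcases hα with ⟨i, j, s, t, hij, hj, hs, ht, rfl⟩ | ⟨ε, hε, hcard, rfl⟩ | ⟨s, hs, rfl⟩
  · obtain ⟨s, rfl, hs'⟩ := exists_int_sign hs
    obtain ⟨t, rfl, ht'⟩ := exists_int_sign ht
    refine ⟨fun k => (if k = i then 2 * s else 0) + (if k = j then 2 * t else 0), ?_, ?_, ?_⟩
    · funext k
      by_cases hk : (k : ℕ) = 6
      · have h1 : k ≠ i := by rintro rfl; omega
        have h2 : k ≠ j := by rintro rfl; omega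
        simp [ofLattice, h1, h2]
      · simp only [ofLattice, latticeScale, hk, if_false]
        push_cast
        split_ifs <;> ring
    · clear hs ht
      fin_cases i <;> fin_cases j <;> simp at hij hj <;>
        simp [IsInRootLattice, Fin.forall_fin_succ] <;> omega
    · fin_cases i <;> fin_cases j <;> simp at hij hj <;>
        rcases hs' with rfl | rfl <;> rcases ht' with rfl | rfl <;> simp [latticeForm]
  · choose a ha ha' using fun k => exists_int_sign (hε k)
    have hmod := (even_card_filter_eq_one_iff ha ha').1 hcard
    have hsq : ∀ k, a k * a k = 1 := fun k => by rcases ha' k with h | h <;> simp [h]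
    refine ⟨a, ?_, ⟨fun k => ?_, ?_⟩, ?_⟩
    · funext k
      simp only [ofLattice, latticeScale, ha]
      split_ifs <;> ring
    · have := ha' k; have := ha' 6; omega
    · have := ha' 6; omega
    · simp only [latticeForm, hsq]; norm_num
  · obtain ⟨s, rfl, hs'⟩ := exists_int_sign hs
    refine ⟨fun k => if (k : ℕ) = 6 then 2 * s else 0, ?_, ?_, ?_⟩
    · funext k
      simp only [ofLattice, latticeScale]
      split_ifs
      · push_cast; ring
      · simp
    · clear hs
      simp [IsInRootLattice, Fin.forall_fin_succ]
      omega
    · rcases hs' with rfl | rfl <;> simp [latticeForm]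

lemma B7_varpiE7_ofLattice (a : Fin 7 → ℤ) :
    B7 varpiE7 (ofLattice a) = ((a 0 + a 6 : ℤ) : ℂ) / 2 := by
  rw [varpiE7_eq_ofLattice, B7_ofLattice]
  simp [latticeForm]
  ring

lemma B7_varpiE7_ofLattice_eq_zero_iff (a : Fin 7 → ℤ) :
    B7 varpiE7 (ofLattice a) = 0 ↔ a 0 + a 6 = 0 := by
  rw [B7_varpiE7_ofLattice, div_eq_zero_iff, Int.cast_eq_zero]
  simp

lemma apply_mem_nilradicalRoots_iff {w : (Fin 7 → ℂ) ≃ₗ[ℂ] (Fin 7 → ℂ)} (hw : w ∈ WmE7)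
    (v : Fin 7 → ℂ) : w v ∈ ofLattice '' nilradicalRoots ↔ v ∈ ofLattice '' nilradicalRoots := by
  induction hw using Subgroup.closure_induction generalizing v with
  | mem w hw =>
    obtain ⟨α, hα, h0, hw⟩ := hw
    obtain ⟨b, rfl, hb, hb8⟩ := exists_lattice_of_mem_PhiE7 hα
    rw [B7_varpiE7_ofLattice_eq_zero_iff] at h0
    have stable : ∀ x ∈ ofLattice '' nilradicalRoots, w x ∈ ofLattice '' nilradicalRoots := by
      rintro _ ⟨a, ha, rfl⟩
      obtain ⟨c, hc⟩ := four_dvd_latticeForm ha.1 hb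
      refine ⟨_, sub_smul_mem_nilradicalRoots ha hb hb8 h0 hc, ?_⟩
      rw [hw, ofLattice_sub_smul, B7_ofLattice, hc]
      push_cast
      rw [mul_div_cancel_left₀ _ (by norm_num)]
    refine ⟨fun h => ?_, stable v⟩
    have h2 : w (w v) = v := by
      rw [hw (w v), hw v, B7_sub_smul, B7_ofLattice, hb8]
      push_cast
      module
    exact h2 ▸ stable _ h
  | one => exact Iff.rfl
  | mul w₁ w₂ _ _ h₁ h₂ => exact (h₁ _).trans (h₂ _)
  | inv w _ h =>
    rw [← h]
    change w (w.symm v) ∈ _ ↔ _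
    rw [w.apply_symm_apply]

/-- The difference `a - b` is a spinor root orthogonal to `ϖ₁` whose reflection takes `a` to `b`. -/
abbrev DiffersBySpinorRoot (a b : Fin 7 → ℤ) : Prop :=
  (∀ k, a k - b k = 1 ∨ a k - b k = -1) ∧
  (a 0 - b 0 + (a 1 - b 1) + (a 2 - b 2) + (a 3 - b 3) + (a 4 - b 4) + (a 5 - b 5)) % 4 = 2 ∧
  a 0 + a 6 = b 0 + b 6 ∧ latticeForm a (a - b) = 4

lemma DiffersBySpinorRoot.exists_mem_WmE7 {a b : Fin 7 → ℤ} (h : DiffersBySpinorRoot a b) :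
    ∃ w ∈ WmE7, w (ofLattice a) = ofLattice b := by
  obtain ⟨hab, h4, h0, hq⟩ := h
  have hβ : B7 (ofLattice (a - b)) (ofLattice (a - b)) = 2 := by
    have hsq : ∀ k, (a k - b k) * (a k - b k) = 1 := fun k => by
      rcases hab k with h | h <;> simp [h]
    rw [B7_ofLattice]
    simp only [latticeForm, Pi.sub_apply, hsq]
    norm_num
  let f : Module.Dual ℂ (Fin 7 → ℂ) :=
    { toFun := fun x => B7 x (ofLattice (a - b))
      map_add' := fun x y => by simp [B7, add_mul, Finset.sum_add_distrib]
      map_smul' := fun c x => by simp [B7, mul_assoc, Finset.mul_sum] }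
  have hf : f (ofLattice (a - b)) = 2 := hβ
  refine ⟨Module.reflection hf, Subgroup.subset_closure
    ⟨ofLattice (a - b), ofLattice_mem_PhiE7 hab h4, ?_, fun x => Module.reflection_apply x hf⟩, ?_⟩
  · rw [B7_varpiE7_ofLattice_eq_zero_iff]
    simp only [Pi.sub_apply]
    omega
  · rw [Module.reflection_apply]
    change ofLattice a - B7 (ofLattice a) (ofLattice (a - b)) • _ = _
    rw [B7_ofLattice, hq]
    funext k
    simp [ofLattice]
    ring

/-- Explicit list of the roots having inner product `1` with `ϖ₁`: `√2·e₇`, the sixteen spinor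
weights, and the ten vectors `e₁ ± e_j`. -/
def nilradicalFinset : Finset (Fin 7 → ℤ) :=
  {![0, 0, 0, 0, 0, 0, 2]} ∪
  (((Fintype.piFinset fun _ : Fin 5 => ({1, -1} : Finset ℤ)).filter
      fun f => (f 0 + f 1 + f 2 + f 3 + f 4) % 4 = 1).image
    fun f => ![1, f 0, f 1, f 2, f 3, f 4, 1]) ∪
  ((Finset.univ ×ˢ ({2, -2} : Finset ℤ)).image
    fun p : Fin 5 × ℤ => Function.update ![2, 0, 0, 0, 0, 0, 0] p.1.succ.castSucc p.2)

lemma card_nilradicalFinset : nilradicalFinset.card = 27 := by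
  decide +kernel

lemma nilradicalFinset_connected : ∀ a ∈ nilradicalFinset,
    a = ![0, 0, 0, 0, 0, 0, 2] ∨ DiffersBySpinorRoot ![0, 0, 0, 0, 0, 0, 2] a ∨
      ∃ b ∈ nilradicalFinset,
        DiffersBySpinorRoot ![0, 0, 0, 0, 0, 0, 2] b ∧ DiffersBySpinorRoot b a := by
  decide +kernel

lemma eq_vec_seven (a : Fin 7 → ℤ) : a = ![a 0, a 1, a 2, a 3, a 4, a 5, a 6] := by
  funext k
  fin_cases k <;> rfl

lemma one_le_mul_self_of_odd {x : ℤ} (hx : x % 2 = 1) : 1 ≤ x * x := by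
  have : x ≠ 0 := by rintro rfl; simp at hx
  have := mul_self_pos.2 this
  omega

lemma mem_nilradicalFinset {a : Fin 7 → ℤ} (ha : a ∈ nilradicalRoots) :
    a ∈ nilradicalFinset := by
  obtain ⟨⟨hpar, hsum⟩, hq, h06⟩ := ha
  have h1 := hpar 1
  have h2 := hpar 2
  have h3 := hpar 3
  have h4 := hpar 4
  have h5 := hpar 5
  rw [eq_vec_seven a]
  unfold latticeForm at hq
  generalize a 0 = x₀, a 1 = x₁, a 2 = x₂, a 3 = x₃, a 4 = x₄, a 5 = x₅, a 6 = x₆ at *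
  obtain rfl : x₀ = 2 - x₆ := by omega
  have n1 := mul_self_nonneg x₁
  have n2 := mul_self_nonneg x₂
  have n3 := mul_self_nonneg x₃
  have n4 := mul_self_nonneg x₄
  have n5 := mul_self_nonneg x₅
  have hlo : 0 ≤ x₆ := by nlinarith
  have hhi : x₆ ≤ 2 := by nlinarith
  interval_cases x₆
  · obtain ⟨y₁, rfl⟩ : (2 : ℤ) ∣ x₁ := by omega
    obtain ⟨y₂, rfl⟩ : (2 : ℤ) ∣ x₂ := by omega
    obtain ⟨y₃, rfl⟩ : (2 : ℤ) ∣ x₃ := by omega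
    obtain ⟨y₄, rfl⟩ : (2 : ℤ) ∣ x₄ := by omega
    obtain ⟨y₅, rfl⟩ : (2 : ℤ) ∣ x₅ := by omega
    have bound : ∀ y : ℤ, y * y ≤ 1 → y = 0 ∨ y = 1 ∨ y = -1 := fun y hy => by
      have : -1 ≤ y := by nlinarith
      have : y ≤ 1 := by nlinarith
      omega
    have b1 := bound y₁ (by linarith)
    have b2 := bound y₂ (by linarith)
    have b3 := bound y₃ (by linarith)
    have b4 := bound y₄ (by linarith)
    have b5 := bound y₅ (by linarith)
    clear n1 n2 n3 n4 n5 h1 h2 h3 h4 h5 hpar bound hlo hhi h06 hsum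
    rcases b1 with rfl | rfl | rfl <;> rcases b2 with rfl | rfl | rfl <;>
      rcases b3 with rfl | rfl | rfl <;> rcases b4 with rfl | rfl | rfl <;>
      rcases b5 with rfl | rfl | rfl <;>
      first
      | (exfalso; revert hq; decide)
      | decide +kernel
  · have := one_le_mul_self_of_odd h1
    have := one_le_mul_self_of_odd h2
    have := one_le_mul_self_of_odd h3
    have := one_le_mul_self_of_odd h4
    have := one_le_mul_self_of_odd h5
    have s1 := mul_self_eq_one_iff.1 (show x₁ * x₁ = 1 by linarith)
    have s2 := mul_self_eq_one_iff.1 (show x₂ * x₂ = 1 by linarith)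
    have s3 := mul_self_eq_one_iff.1 (show x₃ * x₃ = 1 by linarith)
    have s4 := mul_self_eq_one_iff.1 (show x₄ * x₄ = 1 by linarith)
    have s5 := mul_self_eq_one_iff.1 (show x₅ * x₅ = 1 by linarith)
    refine Finset.mem_union_left _ (Finset.mem_union_right _ (Finset.mem_image.2
      ⟨![x₁, x₂, x₃, x₄, x₅], Finset.mem_filter.2 ⟨?_, ?_⟩, rfl⟩))
    · simp [Fintype.mem_piFinset, Fin.forall_fin_succ, s1, s2, s3, s4, s5]
    · change (x₁ + x₂ + x₃ + x₄ + x₅) % 4 = 1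
      omega
  · have z1 := mul_self_eq_zero.1 (show x₁ * x₁ = 0 by linarith)
    have z2 := mul_self_eq_zero.1 (show x₂ * x₂ = 0 by linarith)
    have z3 := mul_self_eq_zero.1 (show x₃ * x₃ = 0 by linarith)
    have z4 := mul_self_eq_zero.1 (show x₄ * x₄ = 0 by linarith)
    have z5 := mul_self_eq_zero.1 (show x₅ * x₅ = 0 by linarith)
    simp [nilradicalFinset, z1, z2, z3, z4, z5]

lemma orbit_varpiE7seven_eq :
    {μ : Fin 7 → ℂ | ∃ w ∈ WmE7, w varpiE7seven = μ} =
      ofLattice '' (nilradicalFinset : Set (Fin 7 → ℤ)) := by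
  rw [varpiE7seven_eq_ofLattice]
  ext μ
  constructor
  · rintro ⟨w, hw, rfl⟩
    have hmem : ![0, 0, 0, 0, 0, 0, 2] ∈ nilradicalRoots := by
      refine ⟨⟨?_, ?_⟩, ?_, ?_⟩ <;> decide
    obtain ⟨a, ha, h⟩ := (apply_mem_nilradicalRoots_iff hw _).2 (Set.mem_image_of_mem _ hmem)
    exact ⟨a, mem_nilradicalFinset ha, h⟩
  · rintro ⟨a, ha, rfl⟩
    rcases nilradicalFinset_connected a ha with rfl | h | ⟨b, -, hb, hba⟩
    · exact ⟨1, one_mem _, rfl⟩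
    · exact h.exists_mem_WmE7
    · obtain ⟨w₁, hw₁, h₁⟩ := hb.exists_mem_WmE7
      obtain ⟨w₂, hw₂, h₂⟩ := hba.exists_mem_WmE7
      exact ⟨w₂ * w₁, mul_mem hw₂ hw₁, by rw [LinearEquiv.mul_apply, h₁, h₂]⟩

/-- The orbit of `ϖ₇` under the Levi Weyl group `W_m` (of type `E₆`) has exactly 27
elements. -/
theorem Wm_orbit_varpi7_card_27 :
    Set.ncard {μ : Fin 7 → ℂ | ∃ w ∈ WmE7, w varpiE7seven = μ} = 27 := by
  rw [orbit_varpiE7seven_eq, Set.ncard_image_of_injective _ ofLattice_injective,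
    Set.ncard_coe_finset, card_nilradicalFinset]
end
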